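/- arXiv:2508.00351 — 2 statements merged into one kernel-verified Lean document; each statement's English description precedes it below -/
import Mathlib

section
/- Let p be a prime with p > 2^{20} and let σ be a positive integer with 0 < |σ − p − 1| ≤ 2√p. Let E : y² = x³ + Ax + B be an elliptic curve over F_p, let α ∈ F_p be a quadratic non-residue, and let E^t : y² = x³ + α⁻²Ax + α⁻³B be the quadratic twist of E. If σ·P = 0 for every point P ∈ E(F_p) and (2p + 2 − σ)·Q = 0 for every point Q ∈ E^t(F_p), then #E(F_p) = σ. -/
/-- The short Weierstrass curve `y² = x³ + Ax + B` over a field `F`. -/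
def shortWeierstrass (F : Type) [Field F] (A B : F) : WeierstrassCurve.Affine F :=
  { a₁ := 0, a₂ := 0, a₃ := 0, a₄ := A, a₆ := B }

namespace Mestre

open WeierstrassCurve.Affine

lemma equation_short {F : Type} [Field F] {a b x y : F} :
    (shortWeierstrass F a b).Equation x y ↔ y ^ 2 = x ^ 3 + a * x + b := by
  rw [equation_iff]; simp [shortWeierstrass]

lemma negY_short {F : Type} [Field F] {a b x y : F} :
    (shortWeierstrass F a b).negY x y = -y := by
  simp [shortWeierstrass, negY]

lemma delta_short {F : Type} [Field F] {a b : F} :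
    (shortWeierstrass F a b).Δ = -16 * (4 * a ^ 3 + 27 * b ^ 2) := by
  simp [shortWeierstrass, WeierstrassCurve.Δ, WeierstrassCurve.b₂, WeierstrassCurve.b₄,
    WeierstrassCurve.b₆, WeierstrassCurve.b₈]
  ring

lemma addX_short {F : Type} [Field F] {a b x₁ x₂ l : F} :
    (shortWeierstrass F a b).addX x₁ x₂ l = l ^ 2 - x₁ - x₂ := by
  simp [shortWeierstrass, addX]

lemma addY_short {F : Type} [Field F] {a b x₁ x₂ y l : F} :
    (shortWeierstrass F a b).addY x₁ x₂ y l = -(l * (l ^ 2 - x₁ - x₂ - x₁) + y) := by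
  simp [shortWeierstrass, addY, negAddY, addX, negY]

lemma add_sub_X {F : Type} [Field F] [DecidableEq F] {a b x₁ y₁ x₂ y₂ : F}
    (h₁ : (shortWeierstrass F a b).Nonsingular x₁ y₁)
    (h₂ : (shortWeierstrass F a b).Nonsingular x₂ y₂) (hx : x₁ ≠ x₂) :
    ∃ x₃ y₃ h₃ x₄ y₄ h₄, Point.some x₁ y₁ h₁ + Point.some x₂ y₂ h₂ = Point.some x₃ y₃ h₃ ∧
      Point.some x₁ y₁ h₁ - Point.some x₂ y₂ h₂ = Point.some x₄ y₄ h₄ ∧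
      x₃ * (x₁ - x₂) ^ 2 = (y₁ - y₂) ^ 2 - (x₁ + x₂) * (x₁ - x₂) ^ 2 ∧
      x₄ * (x₁ - x₂) ^ 2 = (y₁ + y₂) ^ 2 - (x₁ + x₂) * (x₁ - x₂) ^ 2 ∧
      (x₃ + x₄) * (x₁ - x₂) ^ 2 = 2 * ((x₁ * x₂ + a) * (x₁ + x₂) + 2 * b) ∧
      x₃ * x₄ * (x₁ - x₂) ^ 2 = (x₁ * x₂ - a) ^ 2 - 4 * b * (x₁ + x₂) := by
  have e₁ := equation_short.1 h₁.1
  have e₂ := equation_short.1 h₂.1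
  have hd : x₁ - x₂ ≠ 0 := sub_ne_zero.2 hx
  rw [sub_eq_add_neg, Point.neg_some]
  refine ⟨_, _, _, _, _, _, Point.add_of_X_ne hx, Point.add_of_X_ne hx, ?_⟩
  rw [addX_short, addX_short, slope_of_X_ne hx, slope_of_X_ne hx, negY_short]
  have k3 : (((y₁ - y₂) / (x₁ - x₂)) ^ 2 - x₁ - x₂) * (x₁ - x₂) ^ 2
      = (y₁ - y₂) ^ 2 - (x₁ + x₂) * (x₁ - x₂) ^ 2 := by field_simp; ring
  have k4 : (((y₁ - -y₂) / (x₁ - x₂)) ^ 2 - x₁ - x₂) * (x₁ - x₂) ^ 2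
      = (y₁ + y₂) ^ 2 - (x₁ + x₂) * (x₁ - x₂) ^ 2 := by field_simp; ring
  refine ⟨k3, k4, ?_, ?_⟩
  · rw [add_mul, k3, k4]
    linear_combination 2 * e₁ + 2 * e₂
  · apply mul_right_cancel₀ (pow_ne_zero 2 hd)
    set u := ((y₁ - y₂) / (x₁ - x₂)) ^ 2 - x₁ - x₂
    set v := ((y₁ - -y₂) / (x₁ - x₂)) ^ 2 - x₁ - x₂
    have : u * v * (x₁ - x₂) ^ 2 * (x₁ - x₂) ^ 2 = (u * (x₁ - x₂) ^ 2) * (v * (x₁ - x₂) ^ 2) := by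
      ring
    rw [this, k3, k4]
    have : ((y₁ - y₂) ^ 2 - (x₁ + x₂) * (x₁ - x₂) ^ 2) *
      ((y₁ + y₂) ^ 2 - (x₁ + x₂) * (x₁ - x₂) ^ 2) =
      (y₁ ^ 2 - y₂ ^ 2) ^ 2 - 2 * ((x₁ + x₂) * (x₁ - x₂) ^ 2) * (y₁ ^ 2 + y₂ ^ 2) +
        ((x₁ + x₂) * (x₁ - x₂) ^ 2) ^ 2 := by ring
    rw [this, e₁, e₂]
    ring

lemma dbl_X {F : Type} [Field F] [DecidableEq F] {a b x y : F}
    (h : (shortWeierstrass F a b).Nonsingular x y) :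
    (2 * y = 0 ∧ Point.some x y h + Point.some x y h = 0) ∨
    (2 * y ≠ 0 ∧ ∃ x₃ y₃ h₃, Point.some x y h + Point.some x y h = Point.some x₃ y₃ h₃ ∧
      x₃ * (4 * (x ^ 3 + a * x + b)) = (x ^ 2 - a) ^ 2 - 8 * b * x) := by
  have e := equation_short.1 h.1
  by_cases hy : 2 * y = 0
  · left
    refine ⟨hy, Point.add_self_of_Y_eq ?_⟩
    rw [negY_short]; linear_combination hy
  · right
    have hn : y ≠ (shortWeierstrass F a b).negY x y := by
      rw [negY_short]; intro h; apply hy; linear_combination h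
    refine ⟨hy, _, _, _, Point.add_self_of_Y_ne hn, ?_⟩
    rw [addX_short, slope_of_Y_ne rfl hn, negY_short, ← e]
    simp only [shortWeierstrass]
    have h2 : (2:F) ≠ 0 := left_ne_zero_of_mul hy
    have h3 : y ≠ 0 := right_ne_zero_of_mul hy
    have : y - -y = 2 * y := by ring
    rw [this]
    field_simp
    linear_combination (-32 * x) * e

/-- weak representation of the x-coordinate -/
def Wk {F : Type} [Field F] {a b : F} (R : (shortWeierstrass F a b).Point) (X Z : F) : Prop :=
  (R = 0 → Z = 0) ∧ (∀ x y h, R = Point.some x y h → x * Z = X)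

lemma Wk_zero {F : Type} [Field F] {a b : F} {X Z : F} :
    Wk (0 : (shortWeierstrass F a b).Point) X Z ↔ Z = 0 := by
  refine ⟨fun h => h.1 rfl, fun h => ⟨fun _ => h, fun x y k hk => ?_⟩⟩
  exact absurd hk.symm (Point.some_ne_zero k)

lemma Wk_some {F : Type} [Field F] {a b : F} {X Z x y : F} {h} :
    Wk (Point.some x y h : (shortWeierstrass F a b).Point) X Z ↔ x * Z = X := by
  refine ⟨fun k => k.2 _ _ _ rfl, fun k => ⟨fun hk => absurd hk (Point.some_ne_zero h), ?_⟩⟩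
  intro x' y' h' e
  simp only [Point.some.injEq] at e
  rw [← e.1]; exact k

lemma Wk_dbl {F : Type} [Field F] [DecidableEq F] {a b : F}
    (R : (shortWeierstrass F a b).Point) (X Z : F) (hR : Wk R X Z) :
    Wk (R + R) ((X ^ 2 - a * Z ^ 2) ^ 2 - 8 * b * X * Z ^ 3)
      (4 * Z * (X ^ 3 + a * X * Z ^ 2 + b * Z ^ 3)) := by
  rcases R with _ | ⟨x, y, h⟩
  · rw [← Point.zero_def] at hR ⊢
    rw [Wk_zero] at hR
    rw [add_zero, Wk_zero, hR]; ring
  · rw [Wk_some] at hR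
    have e := equation_short.1 h.1
    rcases dbl_X h with ⟨hy, h0⟩ | ⟨hy, x₃, y₃, h₃, h0, hx⟩
    · rw [h0, Wk_zero, ← hR]
      linear_combination (-4 * Z ^ 4) * e + 2 * y * Z ^ 4 * hy
    · rw [h0, Wk_some, ← hR]
      linear_combination Z ^ 4 * hx

lemma Wk_diff {F : Type} [Field F] [DecidableEq F] {a b : F}
    (R R' : (shortWeierstrass F a b).Point) (X₁ Z₁ X₂ Z₂ t y : F) (h)
    (hP : R' - R = Point.some t y h)
    (hR : Wk R X₁ Z₁) (hR' : Wk R' X₂ Z₂) :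
    Wk (R + R') ((X₁ * X₂ - a * (Z₁ * Z₂)) ^ 2 - 4 * b * (Z₁ * Z₂) * (X₁ * Z₂ + X₂ * Z₁))
      (t * (X₁ * Z₂ - X₂ * Z₁) ^ 2) := by
  rcases R with _ | ⟨x₁, y₁, h₁⟩
  · rw [← Point.zero_def] at hR hP ⊢
    rw [sub_zero] at hP
    subst hP
    rw [Wk_zero] at hR
    rw [zero_add, Wk_some, hR]
    rw [Wk_some] at hR'
    rw [← hR']; ring
  · rcases R' with _ | ⟨x₂, y₂, h₂⟩
    · rw [← Point.zero_def] at hR' hP ⊢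
      rw [zero_sub, Point.neg_some] at hP
      simp only [Point.some.injEq] at hP
      rw [add_zero, Wk_some]
      rw [Wk_zero] at hR'
      rw [Wk_some] at hR
      rw [hR', ← hR, hP.1]; ring
    · rw [Wk_some] at hR hR'
      by_cases hx : x₂ = x₁
      · rcases (Point.X_eq_iff (h₁ := h₂) (h₂ := h₁)).1 hx with h | h
        · rw [h, sub_self] at hP
          exact absurd hP.symm (Point.some_ne_zero _)
        · rw [h, add_neg_cancel, Wk_zero, ← hR, ← hR', hx]; ring
      · obtain ⟨x₃, y₃, h₃, x₄, y₄, h₄, i1, i2, -, -, -, i6⟩ := add_sub_X h₂ h₁ hx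
        rw [i2] at hP
        simp only [Point.some.injEq] at hP
        rw [add_comm, i1, Wk_some, ← hP.1, ← hR, ← hR']
        linear_combination (Z₁ * Z₂) ^ 2 * i6

end Mestre

namespace Mestre

open WeierstrassCurve.Affine Polynomial

lemma coeff_mul_of_le {F : Type} [Field F] {f g : F[X]} {m n : ℕ} (hf : f.natDegree ≤ m)
    (hg : g.natDegree ≤ n) : (f * g).natDegree ≤ m + n ∧
      (f * g).coeff (m + n) = f.coeff m * g.coeff n :=
  ⟨natDegree_mul_le_of_le hf hg, coeff_mul_add_eq_of_natDegree_le hf hg⟩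

/-- The polynomial `f` has degree at most `n` and coefficient `c` in degree `n`. -/
def Lead {F : Type} [Field F] (f : F[X]) (n : ℕ) (c : F) : Prop :=
  f.natDegree ≤ n ∧ f.coeff n = c

lemma Lead.mul {F : Type} [Field F] {f g : F[X]} {m n : ℕ} {c d : F} (hf : Lead f m c)
    (hg : Lead g n d) : Lead (f * g) (m + n) (c * d) := by
  obtain ⟨h1, h2⟩ := coeff_mul_of_le hf.1 hg.1
  exact ⟨h1, by rw [h2, hf.2, hg.2]⟩

lemma Lead.add {F : Type} [Field F] {f g : F[X]} {n : ℕ} {c d : F} (hf : Lead f n c)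
    (hg : Lead g n d) : Lead (f + g) n (c + d) :=
  ⟨natDegree_add_le_of_degree_le hf.1 hg.1, by rw [coeff_add, hf.2, hg.2]⟩

lemma Lead.sub {F : Type} [Field F] {f g : F[X]} {n : ℕ} {c d : F} (hf : Lead f n c)
    (hg : Lead g n d) : Lead (f - g) n (c - d) :=
  ⟨natDegree_sub_le_of_le hf.1 hg.1 |>.trans (by simp), by rw [coeff_sub, hf.2, hg.2]⟩

lemma Lead.lt {F : Type} [Field F] {f : F[X]} {m n : ℕ} {c : F} (hf : Lead f m c)
    (h : m < n) : Lead f n 0 :=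
  ⟨hf.1.trans h.le, coeff_eq_zero_of_natDegree_lt (hf.1.trans_lt h)⟩

lemma Lead.cast {F : Type} [Field F] {f g : F[X]} {m n : ℕ} {c d : F} (hf : Lead f m c)
    (h : m = n) (h' : c = d) (e : f = g) : Lead g n d := by subst h h' e; exact hf

lemma Lead_C {F : Type} [Field F] (c : F) : Lead (C c) 0 c := ⟨by simp, by simp⟩
lemma Lead_X {F : Type} [Field F] : Lead (X : F[X]) 1 1 := ⟨by simp, by simp⟩

lemma exists_divpoly {F : Type} [Field F] [DecidableEq F] (a b : F) (n : ℕ) (hn : 1 ≤ n) :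
    ∃ (U V : F[X]) (k : ℕ), k + 2 ≤ 2 * n ^ 2 ∧ Lead U (k + 1) 1 ∧ Lead V k ((n : F) ^ 2) ∧
      ∀ x y (h : (shortWeierstrass F a b).Nonsingular x y),
        Wk (n • Point.some x y h) (U.eval x) (V.eval x) := by
  induction n using Nat.strong_induction_on with
  | _ n ih =>
  rcases Nat.even_or_odd' n with ⟨m, rfl | rfl⟩
  · obtain ⟨U, V, k, hk, hU, hV, hW⟩ := ih m (by omega) (by omega)
    refine ⟨(U * U - C a * (V * V)) * (U * U - C a * (V * V)) - C (8 * b) * (U * (V * (V * V))),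
      C 4 * (V * (U * (U * U) + C a * (U * (V * V)) + C b * (V * (V * V)))), 4 * k + 3, ?_,
      ?_, ?_, ?_⟩
    · nlinarith
    · have i1 := (hU.mul hU).sub (((Lead_C a).mul (hV.mul hV)).lt (n := k + 1 + (k + 1)) (by omega))
      have i2 := ((Lead_C (8 * b)).mul (hU.mul (hV.mul (hV.mul hV)))).lt
        (n := (k + 1 + (k + 1)) + (k + 1 + (k + 1))) (by omega)
      exact ((i1.mul i1).sub i2).cast (by omega) (by ring) rfl
    · have i1 := (hU.mul (hU.mul hU))
      have i2 := (((Lead_C a).mul (hU.mul (hV.mul hV)))).lt (n := k + 1 + (k + 1 + (k + 1)))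
        (by omega)
      have i3 := (((Lead_C b).mul (hV.mul (hV.mul hV)))).lt (n := k + 1 + (k + 1 + (k + 1)))
        (by omega)
      exact ((Lead_C 4).mul (hV.mul ((i1.add i2).add i3))).cast (by omega)
        (by push_cast; ring) rfl
    · intro x y h
      have := Wk_dbl _ _ _ (hW x y h)
      rw [two_mul, add_smul]
      convert this using 1
      · simp; ring
      · simp; ring
  · rcases Nat.eq_zero_or_pos m with rfl | hm
    · refine ⟨X, 1, 0, by norm_num, Lead_X, ⟨by simp, by simp⟩, ?_⟩
      intro x y h
      simp [Wk_some]
    obtain ⟨U₁, V₁, k₁, hk₁, hU₁, hV₁, hW₁⟩ := ih m (by omega) (by omega)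
    obtain ⟨U₂, V₂, k₂, hk₂, hU₂, hV₂, hW₂⟩ := ih (m + 1) (by omega) (by omega)
    refine ⟨(U₁ * U₂ - C a * (V₁ * V₂)) * (U₁ * U₂ - C a * (V₁ * V₂)) -
        C (4 * b) * ((V₁ * V₂) * (U₁ * V₂ + U₂ * V₁)),
      X * ((U₁ * V₂ - U₂ * V₁) * (U₁ * V₂ - U₂ * V₁)), 2 * k₁ + 2 * k₂ + 3, ?_, ?_, ?_, ?_⟩
    · nlinarith
    · have i1 := (hU₁.mul hU₂).sub
        (((Lead_C a).mul (hV₁.mul hV₂)).lt (n := k₁ + 1 + (k₂ + 1)) (by omega))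
      have i3 := ((hU₁.mul hV₂).cast (n := k₁ + k₂ + 1) (by omega) rfl rfl).add
        ((hU₂.mul hV₁).cast (n := k₁ + k₂ + 1) (by omega) rfl rfl)
      have i2 := ((Lead_C (4 * b)).mul ((hV₁.mul hV₂).mul i3)).lt
        (n := (k₁ + 1 + (k₂ + 1)) + (k₁ + 1 + (k₂ + 1))) (by omega)
      exact ((i1.mul i1).sub i2).cast (by omega) (by ring) rfl
    · have i3 := ((hU₁.mul hV₂).cast (n := k₁ + k₂ + 1) (by omega) rfl rfl).sub
        ((hU₂.mul hV₁).cast (n := k₁ + k₂ + 1) (by omega) rfl rfl)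
      exact (Lead_X.mul (i3.mul i3)).cast (by omega) (by push_cast; ring) rfl
    · intro x y h
      have := Wk_diff _ _ _ _ _ _ x y h (by rw [add_smul, one_smul, add_sub_cancel_left])
        (hW₁ x y h) (hW₂ x y h)
      rw [show (2 * m + 1) = m + (m + 1) by ring, add_smul]
      convert this using 1
      · simp; ring
      · simp only [eval_mul, eval_sub, eval_X]; ring

/-- weak bound for the number of torsion points -/
lemma card_torsion {F : Type} [Field F] [DecidableEq F] (a b : F) (n : ℕ) (hn : (n : F) ≠ 0)
    (S : Set (shortWeierstrass F a b).Point) (hS : ∀ P ∈ S, n • P = 0) :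
    S.Finite ∧ S.ncard ≤ 4 * n ^ 2 := by
  have hn1 : 1 ≤ n := by
    rcases Nat.eq_zero_or_pos n with rfl | h
    · simp at hn
    · exact h
  obtain ⟨U, V, k, hk, hU, hV, hW⟩ := exists_divpoly a b n hn1
  have hV0 : V ≠ 0 := by
    rintro rfl
    have := hV.2
    simp at this
    exact hn (by simpa using this.symm)
  classical
  -- the map to (x, sign)
  let R : Finset F := V.roots.toFinset
  have hR : R.card ≤ k := (Multiset.toFinset_card_le _).trans ((card_roots' V).trans hV.1)
  let f : F → Finset (shortWeierstrass F a b).Point := fun x =>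
    if h : ∃ y, (shortWeierstrass F a b).Nonsingular x y then
      {Point.some x h.choose h.choose_spec, -Point.some x h.choose h.choose_spec} else ∅
  have hf : ∀ x, (f x).card ≤ 2 := by
    intro x
    by_cases h : ∃ y, (shortWeierstrass F a b).Nonsingular x y
    · simp only [f, dif_pos h]; exact Finset.card_le_two
    · simp only [f, dif_neg h]; simp
  have hsub : S ⊆ ((insert 0 (R.biUnion f) : Finset (shortWeierstrass F a b).Point) : Set _) := by
    intro P hP
    rcases P with _ | ⟨x, y, h⟩
    · simp [← Point.zero_def]
    · have h0 := hS _ hP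
      have hx := hW x y h
      rw [h0, Wk_zero] at hx
      simp only [Finset.coe_insert, Set.mem_insert_iff, Finset.mem_coe, Finset.mem_biUnion]
      right
      refine ⟨x, by simp [R, hV0, hx], ?_⟩
      have hex : ∃ y, (shortWeierstrass F a b).Nonsingular x y := ⟨y, h⟩
      simp only [f, dif_pos hex, Finset.mem_insert, Finset.mem_singleton]
      exact Point.X_eq_iff.1 rfl
  refine ⟨(Finset.finite_toSet _).subset hsub, ?_⟩
  have h1 := Set.ncard_le_ncard hsub (Finset.finite_toSet _)
  rw [Set.ncard_coe_finset] at h1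
  have h2 := Finset.card_insert_le (0 : (shortWeierstrass F a b).Point) (R.biUnion f)
  have h3 : (R.biUnion f).card ≤ R.card * 2 := Finset.card_biUnion_le_card_mul _ _ _ fun x _ => hf x
  omega

end Mestre

namespace Mestre

open WeierstrassCurve.Affine Polynomial

section scaling
variable {F K : Type} [Field F] [Field K]

lemma scale_nonsing (f : F →+* K) (u : K) (hu : u ≠ 0) {a b : F} {aK bK : K}
    (ha : aK = u ^ 4 * f a) (hb : bK = u ^ 6 * f b) {x y : F}
    (h : (shortWeierstrass F a b).Nonsingular x y) :
    (shortWeierstrass K aK bK).Nonsingular (u ^ 2 * f x) (u ^ 3 * f y) := by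
  rw [nonsingular_iff] at h ⊢
  obtain ⟨h1, h2⟩ := h
  constructor
  · rw [equation_short] at h1 ⊢
    have := congrArg f h1
    simp only [map_add, map_mul, map_pow] at this
    rw [ha, hb]
    linear_combination u ^ 6 * this
  · simp only [shortWeierstrass] at h2 ⊢
    rcases h2 with h2 | h2
    · left
      intro h
      apply h2
      apply f.injective
      simp only [map_add, map_mul, map_pow, map_zero, map_ofNat] at h ⊢
      apply mul_left_cancel₀ (pow_ne_zero 4 hu)
      rw [ha] at h
      linear_combination h
    · right
      intro h
      apply h2
      apply f.injective
      simp only [map_sub, map_neg, map_mul, map_zero] at h ⊢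
      apply mul_left_cancel₀ (pow_ne_zero 3 hu)
      linear_combination h

def scaleFun (f : F →+* K) (u : K) (hu : u ≠ 0) {a b : F} {aK bK : K}
    (ha : aK = u ^ 4 * f a) (hb : bK = u ^ 6 * f b) :
    (shortWeierstrass F a b).Point → (shortWeierstrass K aK bK).Point
  | .zero => .zero
  | .some x y h => .some (u ^ 2 * f x) (u ^ 3 * f y) (scale_nonsing f u hu ha hb h)

lemma scale_add [DecidableEq F] [DecidableEq K] (f : F →+* K) (u : K) (hu : u ≠ 0) {a b : F} {aK bK : K}
    (ha : aK = u ^ 4 * f a) (hb : bK = u ^ 6 * f b) (P Q : (shortWeierstrass F a b).Point) :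
    scaleFun f u hu ha hb (P + Q) = scaleFun f u hu ha hb P + scaleFun f u hu ha hb Q := by
  rcases P with _ | ⟨x₁, y₁, h₁⟩
  · have : scaleFun f u hu ha hb (.zero : (shortWeierstrass F a b).Point) = 0 := rfl
    rw [this, ← Point.zero_def, zero_add, zero_add]
  rcases Q with _ | ⟨x₂, y₂, h₂⟩
  · have : scaleFun f u hu ha hb (.zero : (shortWeierstrass F a b).Point) = 0 := rfl
    rw [this, ← Point.zero_def, add_zero, add_zero]
  have hxi : ∀ {x x' : F}, u ^ 2 * f x = u ^ 2 * f x' ↔ x = x' := by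
    intro x x'
    rw [mul_right_inj' (pow_ne_zero 2 hu), f.injective.eq_iff]
  have hyi : ∀ {x x' : F}, u ^ 3 * f x = u ^ 3 * f x' ↔ x = x' := by
    intro x x'
    rw [mul_right_inj' (pow_ne_zero 3 hu), f.injective.eq_iff]
  by_cases hxy : x₁ = x₂ ∧ y₁ = (shortWeierstrass F a b).negY x₂ y₂
  · rw [Point.add_of_Y_eq hxy.1 hxy.2]
    symm
    apply Point.add_of_Y_eq (hxi.2 hxy.1)
    rw [hxy.2, negY_short, negY_short]; simp
  · have hxy' : ¬ (u ^ 2 * f x₁ = u ^ 2 * f x₂ ∧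
        u ^ 3 * f y₁ = (shortWeierstrass K aK bK).negY (u ^ 2 * f x₂) (u ^ 3 * f y₂)) := by
      intro h
      apply hxy
      refine ⟨hxi.1 h.1, ?_⟩
      rw [negY_short] at h ⊢
      apply hyi.1
      rw [h.2]; simp
    have hs : (shortWeierstrass K aK bK).slope (u ^ 2 * f x₁) (u ^ 2 * f x₂)
        (u ^ 3 * f y₁) (u ^ 3 * f y₂) = u * f ((shortWeierstrass F a b).slope x₁ x₂ y₁ y₂) := by
      by_cases hx : x₁ = x₂
      · have hy : y₁ ≠ (shortWeierstrass F a b).negY x₂ y₂ := fun h => hxy ⟨hx, h⟩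
        have hy' : u ^ 3 * f y₁ ≠
            (shortWeierstrass K aK bK).negY (u ^ 2 * f x₂) (u ^ 3 * f y₂) :=
          fun h => hxy' ⟨hxi.2 hx, h⟩
        have hd : y₁ - (shortWeierstrass F a b).negY x₁ y₁ ≠ 0 := by
          rw [Ne, sub_eq_zero, negY_short]
          rw [negY_short] at hy
          intro h
          rcases Y_eq_of_X_eq h₁.1 h₂.1 hx with h' | h'
          · rw [h'] at h hy; exact hy h
          · rw [negY_short] at h'; exact hy h'
        rw [slope_of_Y_ne hx hy, slope_of_Y_ne (hxi.2 hx) hy']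
        rw [negY_short] at hd ⊢
        rw [negY_short]
        simp only [shortWeierstrass, ha]
        have hd' : f y₁ - -f y₁ ≠ 0 := by
          rw [← map_neg, ← map_sub]
          exact (map_ne_zero f).2 hd
        have hdd : u ^ 3 * f y₁ - -(u ^ 3 * f y₁) ≠ 0 := by
          have := mul_ne_zero (pow_ne_zero 3 hu) hd'
          intro h; apply this; linear_combination h
        simp only [map_div₀, map_sub, map_add, map_mul, map_neg, map_pow, map_ofNat, map_zero]
        rw [mul_div_assoc', div_eq_div_iff hdd hd']
        ring
      · rw [slope_of_X_ne hx, slope_of_X_ne (fun h => hx (hxi.1 h))]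
        have hd : f x₁ - f x₂ ≠ 0 := sub_ne_zero.2 (fun h => hx (f.injective h))
        have hd' : u ^ 2 * f x₁ - u ^ 2 * f x₂ ≠ 0 := sub_ne_zero.2 (fun h => hx (hxi.1 h))
        simp only [map_div₀, map_sub]
        rw [mul_div_assoc', div_eq_div_iff hd' hd]
        ring
    rw [Point.add_some hxy]
    simp only [scaleFun]
    rw [Point.add_some hxy']
    simp only [Point.some.injEq]
    rw [hs, addX_short, addX_short, addY_short, addY_short]
    simp only [map_neg, map_add, map_mul, map_sub, map_pow]
    constructor <;> ring

def scaleHom [DecidableEq F] [DecidableEq K] (f : F →+* K) (u : K) (hu : u ≠ 0) {a b : F} {aK bK : K}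
    (ha : aK = u ^ 4 * f a) (hb : bK = u ^ 6 * f b) :
    (shortWeierstrass F a b).Point →+ (shortWeierstrass K aK bK).Point :=
  AddMonoidHom.mk' (scaleFun f u hu ha hb) (scale_add f u hu ha hb)

end scaling

/-- Both groups killed by `n`, so the product of the orders is at most `16 n²`. -/
lemma card_mul_card_le_aux {K : Type} [Field K] [DecidableEq K] (p : ℕ) [Fact p.Prime]
    (f : ZMod p →+* K) (A B α : ZMod p) (hα : ¬ IsSquare α) (u : K) (hu : u ^ 2 = f α)
    (n : ℕ) (hn : (n : ZMod p) ≠ 0)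
    (hE : ∀ P : (shortWeierstrass (ZMod p) A B).Point, n • P = 0)
    (hEt : ∀ Q : (shortWeierstrass (ZMod p) ((α ^ 2)⁻¹ * A) ((α ^ 3)⁻¹ * B)).Point, n • Q = 0) :
    Nat.card (shortWeierstrass (ZMod p) A B).Point *
      Nat.card (shortWeierstrass (ZMod p) ((α ^ 2)⁻¹ * A) ((α ^ 3)⁻¹ * B)).Point ≤
      16 * n ^ 2 := by
  have hα0 : α ≠ 0 := by rintro rfl; exact hα (by simp)
  have hfα : f α ≠ 0 := (map_ne_zero f).2 hα0
  have hu0 : u ≠ 0 := by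
    rintro rfl
    apply hfα; rw [← hu]; ring
  have huF : ∀ z : ZMod p, f z ≠ u := by
    intro z hz
    apply hα
    refine ⟨z, f.injective ?_⟩
    rw [← hu, ← hz, map_mul, sq]
  let φ : (shortWeierstrass (ZMod p) A B).Point →+ (shortWeierstrass K (f A) (f B)).Point :=
    scaleHom f 1 one_ne_zero (by ring) (by ring)
  let ψ : (shortWeierstrass (ZMod p) ((α ^ 2)⁻¹ * A) ((α ^ 3)⁻¹ * B)).Point →+ (shortWeierstrass K (f A) (f B)).Point :=
    scaleHom f u hu0
      (by rw [show u ^ 4 = (u ^ 2) ^ 2 by ring, hu]; simp only [map_mul, map_inv₀, map_pow]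
          rw [mul_inv_cancel_left₀ (pow_ne_zero _ hfα)])
      (by rw [show u ^ 6 = (u ^ 2) ^ 3 by ring, hu]; simp only [map_mul, map_inv₀, map_pow]
          rw [mul_inv_cancel_left₀ (pow_ne_zero _ hfα)])
  let χ := φ.coprod ψ
  have hrange : ∀ P ∈ (χ.range : Set (shortWeierstrass K (f A) (f B)).Point), n • P = 0 := by
    rintro _ ⟨⟨P, Q⟩, rfl⟩
    rw [← map_nsmul, Prod.smul_mk, hE, hEt]
    exact map_zero χ
  have hnK : (n : K) ≠ 0 := by
    have := (map_ne_zero f).2 hn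
    rwa [map_natCast] at this
  obtain ⟨hfin, hcard⟩ := card_torsion (f A) (f B) n hnK _ hrange
  -- kernel
  let c : (ZMod p)[X] := X ^ 3 + C A * X + C B
  have hc0 : c.natDegree = 3 := by simp only [c]; compute_degree!
  have hc : c ≠ 0 := by intro h; rw [h] at hc0; simp at hc0
  let S : Finset (Option (ZMod p)) := insert none (c.roots.toFinset.image some)
  have hS : S.card ≤ 4 := by
    have h1 := Finset.card_insert_le (none : Option (ZMod p)) (c.roots.toFinset.image some)
    have h2 := Finset.card_image_le (s := c.roots.toFinset) (f := (some : ZMod p → _))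
    have h3 := Multiset.toFinset_card_le c.roots
    have h4 := card_roots' c
    simp only [S]
    omega
  have hker2 : ∀ P Q, (P, Q) ∈ χ.ker → (P = 0 ∧ Q = 0) ∨ ∃ x h h', P = Point.some x 0 h ∧
      Q = Point.some (α⁻¹ * x) 0 h' := by
    intro P Q h
    rw [AddMonoidHom.mem_ker, AddMonoidHom.coprod_apply] at h
    rcases P with _ | ⟨x₁, y₁, h₁⟩
    · rcases Q with _ | ⟨x₂, y₂, h₂⟩
      · left; exact ⟨rfl, rfl⟩
      · exfalso
        change φ 0 + ψ _ = 0 at h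
        rw [map_zero, zero_add] at h
        exact Point.some_ne_zero _ h
    · rcases Q with _ | ⟨x₂, y₂, h₂⟩
      · exfalso
        change φ _ + ψ 0 = 0 at h
        rw [map_zero, add_zero] at h
        exact Point.some_ne_zero _ h
      · right
        rw [add_eq_zero_iff_eq_neg] at h
        change Point.some (1 ^ 2 * f x₁) (1 ^ 3 * f y₁) _ = -Point.some (u ^ 2 * f x₂) (u ^ 3 * f y₂) _ at h
        rw [Point.neg_some, Point.some.injEq, negY_short, hu] at h
        obtain ⟨i1, i2⟩ := h
        have hy2 : y₂ = 0 := by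
          by_contra hy2
          apply huF (-y₁ / (α * y₂))
          have : f y₂ ≠ 0 := (map_ne_zero f).2 hy2
          simp only [map_div₀, map_neg, map_mul]
          rw [div_eq_iff (mul_ne_zero hfα this), ← hu]
          linear_combination -i2
        have hy1 : y₁ = 0 := by
          rw [hy2] at i2
          apply f.injective
          simp only [map_zero] at i2 ⊢
          linear_combination i2
        have hx : x₂ = α⁻¹ * x₁ := by
          rw [eq_inv_mul_iff_mul_eq₀ hα0]
          apply f.injective
          rw [map_mul]
          linear_combination -i1
        subst hy1 hy2 hx
        exact ⟨_, _, _, rfl, rfl⟩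
  let g : (shortWeierstrass (ZMod p) A B).Point → Option (ZMod p) := fun P =>
    match P with
    | .zero => none
    | .some x _ _ => some x
  have hker : Nat.card χ.ker ≤ 4 := by
    let G : χ.ker → S := fun z => ⟨g z.1.1, by
      rcases hker2 z.1.1 z.1.2 z.2 with h | ⟨x, h, h', e1, e2⟩
      · rw [h.1]; exact Finset.mem_insert_self _ _
      · rw [e1]
        apply Finset.mem_insert_of_mem
        apply Finset.mem_image_of_mem
        have := equation_short.1 h.1
        rw [Multiset.mem_toFinset, mem_roots hc, IsRoot]
        simp only [c, eval_add, eval_mul, eval_pow, eval_X, eval_C]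
        rw [← this]; ring⟩
    have hG : Function.Injective G := by
      rintro ⟨⟨P, Q⟩, hz⟩ ⟨⟨P', Q'⟩, hz'⟩ h
      simp only [G, Subtype.mk.injEq] at h
      rcases hker2 P Q hz with ⟨rfl, rfl⟩ | ⟨x, i1, i2, rfl, rfl⟩ <;>
      rcases hker2 P' Q' hz' with ⟨rfl, rfl⟩ | ⟨x', i1', i2', rfl, rfl⟩
      · rfl
      · exact absurd h (by intro h; cases h)
      · exact absurd h (by intro h; cases h)
      · have : x = x' := Option.some.inj h
        subst this
        rfl
    have := Nat.card_le_card_of_injective G hG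
    rw [Nat.card_eq_fintype_card (α := S), Fintype.card_coe] at this
    exact this.trans hS
  rw [← Nat.card_prod, ← χ.ker.card_mul_index, AddSubgroup.index_ker, mul_comm]
  have : Nat.card χ.range = (χ.range : Set (shortWeierstrass K (f A) (f B)).Point).ncard := rfl
  rw [this]
  calc _ ≤ (4 * n ^ 2) * 4 := Nat.mul_le_mul hcard hker
    _ = _ := by ring

lemma card_mul_card_le (p : ℕ) [Fact p.Prime] (A B α : ZMod p) (hα : ¬ IsSquare α)
    (n : ℕ) (hn : (n : ZMod p) ≠ 0)
    (hE : ∀ P : (shortWeierstrass (ZMod p) A B).Point, n • P = 0)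
    (hEt : ∀ Q : (shortWeierstrass (ZMod p) ((α ^ 2)⁻¹ * A) ((α ^ 3)⁻¹ * B)).Point, n • Q = 0) :
    Nat.card (shortWeierstrass (ZMod p) A B).Point *
      Nat.card (shortWeierstrass (ZMod p) ((α ^ 2)⁻¹ * A) ((α ^ 3)⁻¹ * B)).Point ≤
      16 * n ^ 2 := by
  classical
  obtain ⟨u, hu⟩ : ∃ u : AlgebraicClosure (ZMod p), u ^ 2 = algebraMap (ZMod p) _ α :=
    IsAlgClosed.exists_pow_nat_eq _ (by norm_num)
  exact card_mul_card_le_aux p _ A B α hα u hu n hn hE hEt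

end Mestre

namespace Mestre

open WeierstrassCurve.Affine Polynomial

lemma card_short (p : ℕ) [Fact p.Prime] (hp2 : p ≠ 2) (a b : ZMod p)
    (hΔ : (shortWeierstrass (ZMod p) a b).Δ ≠ 0) :
    (Nat.card (shortWeierstrass (ZMod p) a b).Point : ℤ) =
      p + 1 + ∑ x : ZMod p, quadraticChar (ZMod p) (x ^ 3 + a * x + b) := by
  haveI : (shortWeierstrass (ZMod p) a b).IsElliptic := ⟨isUnit_iff_ne_zero.2 hΔ⟩
  rw [Nat.card_congr (pointEquiv (shortWeierstrass (ZMod p) a b))]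
  let e : {xy : ZMod p × ZMod p // (shortWeierstrass (ZMod p) a b).Equation xy.fst xy.snd} ≃
      Σ x : ZMod p, {y : ZMod p // y ^ 2 = x ^ 3 + a * x + b} :=
    { toFun := fun z => ⟨z.1.1, z.1.2, equation_short.1 z.2⟩
      invFun := fun z => ⟨(z.1, z.2.1), equation_short.2 z.2.2⟩
      left_inv := fun _ => rfl
      right_inv := fun _ => rfl }
  have h1 : Nat.card (WithZero {xy : ZMod p × ZMod p //
      (shortWeierstrass (ZMod p) a b).Equation xy.fst xy.snd}) =
      Nat.card {xy : ZMod p × ZMod p //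
      (shortWeierstrass (ZMod p) a b).Equation xy.fst xy.snd} + 1 := Finite.card_option
  rw [h1, Nat.card_congr e, Nat.card_sigma]
  push_cast
  have h2 : ∀ x : ZMod p, (Nat.card {y : ZMod p // y ^ 2 = x ^ 3 + a * x + b} : ℤ) =
      quadraticChar (ZMod p) (x ^ 3 + a * x + b) + 1 := by
    intro x
    rw [← quadraticChar_card_sqrts (by rwa [ZMod.ringChar_zmod_n])]
    congr 1
    rw [Set.toFinset_card, Nat.card_eq_fintype_card]
    rfl
  simp only [h2, Finset.sum_add_distrib]
  simp
  ring

lemma delta_twist (p : ℕ) [Fact p.Prime] (a b α : ZMod p) (hα : α ≠ 0)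
    (hΔ : (shortWeierstrass (ZMod p) a b).Δ ≠ 0) :
    (shortWeierstrass (ZMod p) ((α ^ 2)⁻¹ * a) ((α ^ 3)⁻¹ * b)).Δ ≠ 0 := by
  rw [delta_short] at hΔ ⊢
  have : -16 * (4 * ((α ^ 2)⁻¹ * a) ^ 3 + 27 * ((α ^ 3)⁻¹ * b) ^ 2) =
    (α⁻¹) ^ 6 * (-16 * (4 * a ^ 3 + 27 * b ^ 2)) := by
    simp only [← inv_pow]; ring
  rw [this]
  exact mul_ne_zero (pow_ne_zero _ (inv_ne_zero hα)) hΔ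

lemma sum_twist (p : ℕ) [Fact p.Prime] (hp2 : p ≠ 2) (a b α : ZMod p) (hα : ¬ IsSquare α) :
    ∑ x : ZMod p, quadraticChar (ZMod p) (x ^ 3 + (α ^ 2)⁻¹ * a * x + (α ^ 3)⁻¹ * b) =
      - ∑ x : ZMod p, quadraticChar (ZMod p) (x ^ 3 + a * x + b) := by
  have hα0 : α ≠ 0 := by rintro rfl; exact hα (by simp)
  rw [← Finset.sum_neg_distrib, 
    ← Equiv.sum_comp (Equiv.mulLeft₀ α hα0)
      (fun x => -quadraticChar (ZMod p) (x ^ 3 + a * x + b))]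
  refine Finset.sum_congr rfl fun x _ => ?_
  have hc : quadraticChar (ZMod p) α = -1 := quadraticChar_neg_one_iff_not_isSquare.2 hα
  have : (Equiv.mulLeft₀ α hα0 x) ^ 3 + a * (Equiv.mulLeft₀ α hα0 x) + b =
      α ^ 3 * (x ^ 3 + (α ^ 2)⁻¹ * a * x + (α ^ 3)⁻¹ * b) := by
    change (α * x) ^ 3 + a * (α * x) + b = _
    field_simp
  rw [this, map_mul, map_pow, hc]
  ring

end Mestre

namespace Mestre

open WeierstrassCurve.Affine Polynomial

section height
variable {F : Type} [Field F]

/-- degree of a rational function -/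
noncomputable def ht (x : RatFunc F) : ℕ := max x.num.natDegree x.denom.natDegree

lemma ht_algebraMap (f : F[X]) : ht (algebraMap F[X] (RatFunc F) f) = f.natDegree := by
  simp [ht]

lemma ht_le (x : RatFunc F) (n d : F[X]) (hd : d ≠ 0) (D : ℕ) (hn : n.natDegree ≤ D)
    (hdD : d.natDegree ≤ D)
    (e : x * algebraMap F[X] (RatFunc F) d = algebraMap F[X] (RatFunc F) n) : ht x ≤ D := by
  have hd' : algebraMap F[X] (RatFunc F) d ≠ 0 := by
    rw [Ne, FaithfulSMul.algebraMap_eq_zero_iff]; exact hd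
  have hx : x = algebraMap F[X] (RatFunc F) n / algebraMap F[X] (RatFunc F) d := by
    rw [eq_div_iff hd', e]
  apply max_le
  · by_cases h0 : n = 0
    · rw [hx, h0]; simp
    · rw [hx]
      exact (natDegree_le_of_dvd (RatFunc.num_div_dvd n hd) h0).trans hn
  · rw [hx]
    exact (natDegree_le_of_dvd (RatFunc.denom_div_dvd n d) hd).trans hdD

lemma poly_sym {X₁ Z₁ X₂ Z₂ f g h : F[X]} (c₁ : IsCoprime X₁ Z₁) (c₂ : IsCoprime X₂ Z₂)
    (hZ₁ : Z₁ ≠ 0) (hZ₂ : Z₂ ≠ 0) (hf : f ≠ 0)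
    (e₁ : X₁ * X₂ * f = Z₁ * Z₂ * h) (e₂ : (X₁ * Z₂ + X₂ * Z₁) * f = Z₁ * Z₂ * g) :
    ∃ k, k ≠ 0 ∧ f = k * (Z₁ * Z₂) ∧ g = k * (X₁ * Z₂ + X₂ * Z₁) ∧ h = k * (X₁ * X₂) := by
  have d1 : Z₁ ∣ X₂ * f := by
    apply IsCoprime.dvd_of_dvd_mul_left c₁.symm (z := X₂ * f)
    exact ⟨Z₂ * h, by linear_combination e₁⟩
  have d2 : Z₁ ∣ Z₂ * f := by
    apply IsCoprime.dvd_of_dvd_mul_left c₁.symm (z := Z₂ * f)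
    exact ⟨Z₂ * g - X₂ * f, by linear_combination e₂⟩
  have d3 : Z₁ ∣ f := by
    obtain ⟨u, v, huv⟩ := c₂
    have : f = u * (X₂ * f) + v * (Z₂ * f) := by linear_combination (-f) * huv
    rw [this]
    exact dvd_add (d1.mul_left _) (d2.mul_left _)
  obtain ⟨f', rfl⟩ := d3
  have e₁' : X₁ * X₂ * f' = Z₂ * h := mul_left_cancel₀ hZ₁ (by linear_combination e₁)
  have e₂' : (X₁ * Z₂ + X₂ * Z₁) * f' = Z₂ * g := mul_left_cancel₀ hZ₁ (by linear_combination e₂)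
  have d4 : Z₂ ∣ X₁ * f' := by
    apply IsCoprime.dvd_of_dvd_mul_left c₂.symm (z := X₁ * f')
    exact ⟨h, by linear_combination e₁'⟩
  have d5 : Z₂ ∣ Z₁ * f' := by
    apply IsCoprime.dvd_of_dvd_mul_left c₂.symm (z := Z₁ * f')
    exact ⟨g - X₁ * f', by linear_combination e₂'⟩
  have d6 : Z₂ ∣ f' := by
    obtain ⟨u, v, huv⟩ := c₁
    have : f' = u * (X₁ * f') + v * (Z₁ * f') := by linear_combination (-f') * huv
    rw [this]
    exact dvd_add (d4.mul_left _) (d5.mul_left _)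
  obtain ⟨k, rfl⟩ := d6
  refine ⟨k, ?_, by ring, ?_, ?_⟩
  · rintro rfl; simp at hf
  · exact mul_left_cancel₀ hZ₂ (by linear_combination -e₂')
  · exact mul_left_cancel₀ hZ₂ (by linear_combination -e₁')

lemma natDegree_le_mul {k a : F[X]} (hk : k ≠ 0) : a.natDegree ≤ (k * a).natDegree := by
  by_cases ha : a = 0
  · simp [ha]
  · rw [natDegree_mul hk ha]; omega

lemma ht_sym (x₁ x₂ : RatFunc F) (f g h : F[X]) (hf : f ≠ 0) (D : ℕ)
    (hfD : f.natDegree ≤ D) (hgD : g.natDegree ≤ D) (hhD : h.natDegree ≤ D)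
    (e₁ : x₁ * x₂ * algebraMap F[X] (RatFunc F) f = algebraMap F[X] (RatFunc F) h)
    (e₂ : (x₁ + x₂) * algebraMap F[X] (RatFunc F) f = algebraMap F[X] (RatFunc F) g) :
    ht x₁ + ht x₂ ≤ D := by
  have n1 := x₁.num_div_denom
  have n2 := x₂.num_div_denom
  have z1 := x₁.denom_ne_zero
  have z2 := x₂.denom_ne_zero
  have c1 := x₁.isCoprime_num_denom
  have c2 := x₂.isCoprime_num_denom
  unfold ht
  set X₁ := x₁.num
  set X₂ := x₂.num
  set Z₁ := x₁.denom
  set Z₂ := x₂.denom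
  have inj : Function.Injective (algebraMap F[X] (RatFunc F)) := FaithfulSMul.algebraMap_injective _ _
  have z1' : algebraMap F[X] (RatFunc F) Z₁ ≠ 0 := by
    rw [Ne, FaithfulSMul.algebraMap_eq_zero_iff]; exact z1
  have z2' : algebraMap F[X] (RatFunc F) Z₂ ≠ 0 := by
    rw [Ne, FaithfulSMul.algebraMap_eq_zero_iff]; exact z2
  rw [div_eq_iff z1'] at n1
  rw [div_eq_iff z2'] at n2
  obtain ⟨k, hk, k1, k2, k3⟩ := poly_sym (f := f) (g := g) (h := h) c1 c2 z1 z2 hf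
    (inj (by
      simp only [map_mul]
      rw [n1, n2, ← e₁]; ring))
    (inj (by
      simp only [map_mul, map_add]
      rw [n1, n2, ← e₂]; ring))
  have b1 : (Z₁ * Z₂).natDegree ≤ D := (natDegree_le_mul hk).trans (k1 ▸ hfD)
  have b2 : (X₁ * Z₂ + X₂ * Z₁).natDegree ≤ D := (natDegree_le_mul hk).trans (k2 ▸ hgD)
  have b3 : (X₁ * X₂).natDegree ≤ D := (natDegree_le_mul hk).trans (k3 ▸ hhD)
  rw [natDegree_mul z1 z2] at b1
  rcases le_or_gt X₁.natDegree Z₁.natDegree with i1 | i1 <;>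
  rcases le_or_gt X₂.natDegree Z₂.natDegree with i2 | i2
  · rw [max_eq_right i1, max_eq_right i2]; exact b1
  · rw [max_eq_right i1, max_eq_left i2.le]
    have hX2 : X₂ ≠ 0 := by intro h; rw [h] at i2; simp at i2
    have hd : (X₂ * Z₁).natDegree = X₂.natDegree + Z₁.natDegree := natDegree_mul hX2 z1
    have hl : (X₁ * Z₂).natDegree < (X₂ * Z₁).natDegree := by
      rw [hd]
      have := natDegree_mul_le (p := X₁) (q := Z₂)
      omega
    rw [natDegree_add_eq_right_of_natDegree_lt hl, hd] at b2
    omega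
  · rw [max_eq_left i1.le, max_eq_right i2]
    have hX1 : X₁ ≠ 0 := by intro h; rw [h] at i1; simp at i1
    have hd : (X₁ * Z₂).natDegree = X₁.natDegree + Z₂.natDegree := natDegree_mul hX1 z2
    have hl : (X₂ * Z₁).natDegree < (X₁ * Z₂).natDegree := by
      rw [hd]
      have := natDegree_mul_le (p := X₂) (q := Z₁)
      omega
    rw [natDegree_add_eq_left_of_natDegree_lt hl, hd] at b2
    omega
  · have hX1 : X₁ ≠ 0 := by intro h; rw [h] at i1; simp at i1
    have hX2 : X₂ ≠ 0 := by intro h; rw [h] at i2; simp at i2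
    rw [natDegree_mul hX1 hX2] at b3
    rw [max_eq_left i1.le, max_eq_left i2.le]; exact b3

/-- height of a point on the twist by `l` -/
noncomputable def hpt {a b : RatFunc F} (l : RatFunc F) :
    (shortWeierstrass (RatFunc F) a b).Point → ℕ
  | .zero => 0
  | .some x _ _ => ht (x / l)

lemma hpt_zero {a b : RatFunc F} (l : RatFunc F) :
    hpt l (0 : (shortWeierstrass (RatFunc F) a b).Point) = 0 := rfl

lemma hpt_some {a b : RatFunc F} (l x y : RatFunc F) (h) :
    hpt l (Point.some x y h : (shortWeierstrass (RatFunc F) a b).Point) = ht (x / l) := rfl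

lemma hpt_neg {a b : RatFunc F} (l : RatFunc F) (P : (shortWeierstrass (RatFunc F) a b).Point) :
    hpt l (-P) = hpt l P := by
  rcases P with _ | ⟨x, y, h⟩
  · rfl
  · rw [Point.neg_some]; rfl

/-- the cubic polynomial -/
noncomputable def lam (A B : F) : F[X] := X ^ 3 + C A * X + C B

lemma lam_natDegree (A B : F) : (lam A B).natDegree = 3 := by
  unfold lam; compute_degree!

lemma lam_ne_zero (A B : F) : lam A B ≠ 0 := by
  intro h; have := lam_natDegree A B; rw [h] at this; simp at this

/-- the cubic polynomial as a rational function -/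
noncomputable def ll (A B : F) : RatFunc F := algebraMap F[X] (RatFunc F) (lam A B)

lemma ll_ne_zero (A B : F) : ll A B ≠ 0 := by
  unfold ll; rw [Ne, FaithfulSMul.algebraMap_eq_zero_iff]; exact lam_ne_zero A B

lemma ll_eq (A B : F) : ll A B = (algebraMap F[X] (RatFunc F) X) ^ 3 +
    algebraMap F[X] (RatFunc F) (C A) * (algebraMap F[X] (RatFunc F) X) +
    algebraMap F[X] (RatFunc F) (C B) := by
  simp [ll, lam]

/-- The twist of the curve by `lam`. -/
noncomputable abbrev TW (A B : F) : WeierstrassCurve.Affine (RatFunc F) :=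
  shortWeierstrass (RatFunc F) (algebraMap F[X] (RatFunc F) (C A) * ll A B ^ 2)
    (algebraMap F[X] (RatFunc F) (C B) * ll A B ^ 3)

lemma para_deg (A B : F) (U V : F[X]) (d : ℕ) (dX : U.natDegree ≤ d) (dZ : V.natDegree ≤ d) :
    ((U - V * X) * (U - V * X)).natDegree ≤ 2 * d + 2 ∧
    (C 2 * ((U * X + C A * V) * (U + V * X) + C (2 * B) * (V * V))).natDegree ≤ 2 * d + 2 ∧
    ((U * X - C A * V) * (U * X - C A * V) - C (4 * B) * (V * (U + V * X))).natDegree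
      ≤ 2 * d + 2 := by
  have LU : Lead U d (U.coeff d) := ⟨dX, rfl⟩
  have LV : Lead V d (V.coeff d) := ⟨dZ, rfl⟩
  have LU' := LU.lt (n := d + 1) (by omega)
  have LV' := LV.lt (n := d + 1) (by omega)
  have LXU := (LU.mul Lead_X)
  have LXV := (LV.mul Lead_X)
  have LAV := ((Lead_C A).mul LV').cast (n := d + 1) (by omega) rfl rfl
  have L1 := LU'.sub LXV
  have L2 := LU'.add LXV
  have L3 := LXU.add LAV
  have L4 := LXU.sub LAV
  have L5 := ((Lead_C (2 * B)).mul (LV'.mul LV')).cast (n := d + 1 + (d + 1)) (by omega) rfl rfl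
  have L6 := ((Lead_C (4 * B)).mul (LV'.mul L2)).cast (n := d + 1 + (d + 1)) (by omega) rfl rfl
  refine ⟨?_, ?_, ?_⟩
  · have := (L1.mul L1).1; omega
  · have := ((Lead_C 2).mul ((L3.mul L2).add L5)).1; omega
  · have := ((L4.mul L4).sub L6).1; omega

lemma para_core (A B : F) (ξ ξ₃ ξ₄ : RatFunc F)
    (hne : ξ ≠ algebraMap F[X] (RatFunc F) X)
    (i5 : (ξ₃ + ξ₄) * (ξ - algebraMap F[X] (RatFunc F) X) ^ 2 =
      2 * ((ξ * algebraMap F[X] (RatFunc F) X + algebraMap F[X] (RatFunc F) (C A)) *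
        (ξ + algebraMap F[X] (RatFunc F) X) + 2 * algebraMap F[X] (RatFunc F) (C B)))
    (i6 : ξ₃ * ξ₄ * (ξ - algebraMap F[X] (RatFunc F) X) ^ 2 =
      (ξ * algebraMap F[X] (RatFunc F) X - algebraMap F[X] (RatFunc F) (C A)) ^ 2 -
        4 * algebraMap F[X] (RatFunc F) (C B) * (ξ + algebraMap F[X] (RatFunc F) X)) :
    ht ξ₃ + ht ξ₄ ≤ 2 * ht ξ + 2 := by
  have n1 := ξ.num_div_denom
  have z1 := ξ.denom_ne_zero
  have dX : ξ.num.natDegree ≤ ht ξ := le_max_left _ _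
  have dZ : ξ.denom.natDegree ≤ ht ξ := le_max_right _ _
  generalize ξ.num = U at *
  generalize ξ.denom = V at *
  generalize ht ξ = d at *
  have z1' : algebraMap F[X] (RatFunc F) V ≠ 0 := by
    rw [Ne, FaithfulSMul.algebraMap_eq_zero_iff]; exact z1
  rw [div_eq_iff z1'] at n1
  obtain ⟨b1, b2, b3⟩ := para_deg A B U V d dX dZ
  refine ht_sym ξ₃ ξ₄ _ _ _ ?_ (2 * d + 2) b1 b2 b3 ?_ ?_
  · apply mul_self_ne_zero.2
    intro h0
    apply hne
    have := congrArg (algebraMap F[X] (RatFunc F)) h0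
    simp only [map_sub, map_mul, map_zero] at this
    rw [n1] at this
    have : algebraMap F[X] (RatFunc F) V * (ξ - algebraMap F[X] (RatFunc F) X) = 0 := by
      linear_combination this
    rw [mul_eq_zero] at this
    rw [sub_eq_zero.1 (this.resolve_left z1')]
  · simp only [map_sub, map_mul, map_add, n1]
    simp only [map_ofNat]
    linear_combination (algebraMap F[X] (RatFunc F) V) ^ 2 * i6
  · simp only [map_sub, map_mul, map_add, n1]
    simp only [map_ofNat]
    linear_combination (algebraMap F[X] (RatFunc F) V) ^ 2 * i5

lemma scale_id {K : Type} [Field K] {l a b x ξ ξ₃ ξ₄ : K} (hl : l ≠ 0)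
    (i5 : (l * ξ₃ + l * ξ₄) * (l * ξ - l * x) ^ 2 =
      2 * ((l * ξ * (l * x) + a * l ^ 2) * (l * ξ + l * x) + 2 * (b * l ^ 3)))
    (i6 : l * ξ₃ * (l * ξ₄) * (l * ξ - l * x) ^ 2 =
      (l * ξ * (l * x) - a * l ^ 2) ^ 2 - 4 * (b * l ^ 3) * (l * ξ + l * x)) :
    (ξ₃ + ξ₄) * (ξ - x) ^ 2 = 2 * ((ξ * x + a) * (ξ + x) + 2 * b) ∧
    ξ₃ * ξ₄ * (ξ - x) ^ 2 = (ξ * x - a) ^ 2 - 4 * b * (ξ + x) := by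
  constructor
  · apply mul_left_cancel₀ (pow_ne_zero 3 hl)
    linear_combination i5
  · apply mul_left_cancel₀ (pow_ne_zero 4 hl)
    linear_combination i6

lemma para_of_ne [DecidableEq (RatFunc F)] (A B : F) (x₁ y₁ y : RatFunc F)
    (h₁ : (TW A B).Nonsingular x₁ y₁)
    (h : (TW A B).Nonsingular (ll A B * algebraMap F[X] (RatFunc F) X) y)
    (hne : x₁ ≠ ll A B * algebraMap F[X] (RatFunc F) X) :
    hpt (ll A B) (Point.some x₁ y₁ h₁ + Point.some _ y h) +
      hpt (ll A B) (Point.some x₁ y₁ h₁ - Point.some _ y h) ≤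
      2 * hpt (ll A B) (Point.some x₁ y₁ h₁) + 2 := by
  have hl := ll_ne_zero A B
  obtain ⟨x₃, y₃, h₃, x₄, y₄, h₄, i1, i2, -, -, i5, i6⟩ := add_sub_X h₁ h hne
  rw [i1, i2, hpt_some, hpt_some, hpt_some]
  clear i1 i2 h₁ h h₃ h₄
  obtain ⟨ξ, rfl⟩ : ∃ ξ, x₁ = ll A B * ξ := ⟨x₁ / ll A B, by field_simp⟩
  obtain ⟨ξ₃, rfl⟩ : ∃ ξ, x₃ = ll A B * ξ := ⟨x₃ / ll A B, by field_simp⟩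
  obtain ⟨ξ₄, rfl⟩ : ∃ ξ, x₄ = ll A B * ξ := ⟨x₄ / ll A B, by field_simp⟩
  obtain ⟨j5, j6⟩ := scale_id hl i5 i6
  simp only [mul_div_cancel_left₀ _ hl]
  exact para_core A B ξ ξ₃ ξ₄ (fun h => hne (by rw [h])) j5 j6

lemma hpt_dbl [DecidableEq (RatFunc F)] (A B : F) (y : RatFunc F)
    (h : (TW A B).Nonsingular (ll A B * algebraMap F[X] (RatFunc F) X) y) :
    hpt (ll A B) (Point.some _ y h + Point.some _ y h) ≤ 4 := by
  have hl := ll_ne_zero A B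
  rcases dbl_X h with ⟨-, h0⟩ | ⟨hy, x₃, y₃, h₃, h0, hx⟩
  · rw [h0, hpt_zero]; omega
  · rw [h0, hpt_some]
    have h2 : (2 : F) ≠ 0 := by
      intro h2
      apply left_ne_zero_of_mul hy
      have := congrArg (algebraMap F (RatFunc F)) h2
      rwa [map_ofNat, map_zero] at this
    have h4 : (4 : F) ≠ 0 := by
      have : (4 : F) = 2 * 2 := by norm_num
      rw [this]; exact mul_ne_zero h2 h2
    obtain ⟨ξ₃, rfl⟩ : ∃ ξ, x₃ = ll A B * ξ := ⟨x₃ / ll A B, by field_simp⟩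
    simp only [mul_div_cancel_left₀ _ hl]
    refine ht_le ξ₃ ((X ^ 2 - C A) ^ 2 - C (8 * B) * X) (C 4 * lam A B) ?_ 4 ?_ ?_ ?_
    · exact mul_ne_zero (C_ne_zero.2 h4) (lam_ne_zero A B)
    · compute_degree!
    · rw [natDegree_C_mul h4, lam_natDegree]; omega
    · apply mul_left_cancel₀ (pow_ne_zero 4 hl)
      have e := ll_eq A B
      have : algebraMap F[X] (RatFunc F) (lam A B) = ll A B := rfl
      simp only [map_sub, map_mul, map_pow, this]
      simp only [map_ofNat]
      linear_combination hx + 4 * ξ₃ * (ll A B) ^ 4 * e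

lemma para [DecidableEq (RatFunc F)] (A B : F) (y : RatFunc F)
    (h : (TW A B).Nonsingular (ll A B * algebraMap F[X] (RatFunc F) X) y)
    (P : (TW A B).Point) :
    hpt (ll A B) (P + Point.some _ y h) + hpt (ll A B) (P - Point.some _ y h) ≤
      2 * hpt (ll A B) P + 2 := by
  have hl := ll_ne_zero A B
  have hQ : hpt (ll A B) (Point.some _ y h) = 1 := by
    rw [hpt_some, mul_div_cancel_left₀ _ hl, ht_algebraMap, natDegree_X]
  have h4 := hpt_dbl A B y h
  rcases P with _ | ⟨x₁, y₁, h₁⟩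
  · rw [← Point.zero_def, zero_add, zero_sub, hpt_neg, hQ, hpt_zero]
  · by_cases hx : x₁ = ll A B * algebraMap F[X] (RatFunc F) X
    · rcases (Point.X_eq_iff (h₁ := h₁) (h₂ := h)).1 hx with e | e
      · rw [e, sub_self, hpt_zero, hQ]; omega
      · rw [e, neg_add_cancel, hpt_zero, ← neg_add', hpt_neg, hpt_neg, hQ]; omega
    · exact para_of_ne A B x₁ y₁ y h₁ h hx

lemma six_bound [DecidableEq (RatFunc F)] (A B : F) (y : RatFunc F)
    (h : (TW A B).Nonsingular (ll A B * algebraMap F[X] (RatFunc F) X) y)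
    (P : (TW A B).Point) :
    5 * hpt (ll A B) P ≤ 6 * hpt (ll A B) (P + Point.some _ y h) + 30 := by
  have para' := para A B y h
  generalize (Point.some _ y h : (TW A B).Point) = Q at para' ⊢
  have k : ∀ n : ℕ, hpt (ll A B) (P + (n + 2) • Q) + hpt (ll A B) (P + n • Q) ≤
      2 * hpt (ll A B) (P + (n + 1) • Q) + 2 := by
    intro n
    have := para' (P + (n + 1) • Q)
    have e1 : P + (n + 1) • Q + Q = P + (n + 2) • Q := by
      rw [add_assoc, ← succ_nsmul]
    have e2 : P + (n + 1) • Q - Q = P + n • Q := by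
      rw [succ_nsmul, ← add_assoc, add_sub_cancel_right]
    rwa [e1, e2] at this
  have k0 := k 0
  have k1 := k 1
  have k2 := k 2
  have k3 := k 3
  have k4 := k 4
  simp only [zero_nsmul, add_zero, zero_add, one_nsmul, Nat.reduceAdd] at k0 k1 k2 k3 k4
  omega

end height

end Mestre

namespace Mestre

open WeierstrassCurve.Affine Polynomial

section hasse

lemma prod_dvd_of_roots {F : Type} [Field F] (s : Finset F) (f : F[X])
    (h : ∀ a ∈ s, f.eval a = 0) : ∏ a ∈ s, (X - C a) ∣ f := by
  apply Finset.prod_dvd_of_coprime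
  · intro a _ b _ hab
    exact pairwise_coprime_X_sub_C Function.injective_id hab
  · intro a ha
    exact dvd_iff_isRoot.2 (h a ha)

variable (p : ℕ) [Fact p.Prime]

lemma lam_eval (A B a : ZMod p) : (lam A B).eval a = a ^ 3 + A * a + B := by
  simp [lam]

lemma lam_pow_p (A B : ZMod p) : (lam A B) ^ p = X ^ (3 * p) + C A * X ^ p + C B := by
  rw [← ZMod.expand_card]
  simp [lam, expand_X]
  ring

lemma lam_G (hp2 : p ≠ 2) (A B : ZMod p) :
    lam A B * (lam A B ^ (p / 2)) ^ 2 = X ^ (3 * p) + C A * X ^ p + C B := by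
  rw [← lam_pow_p]
  have := (Fact.out : p.Prime).eq_two_or_odd
  rw [← pow_mul, ← pow_succ']
  congr 1
  omega

/-- numerator of the coordinate of the sum -/
noncomputable def numr (A B : ZMod p) (ε : ℤ) : (ZMod p)[X] :=
  lam A B * (lam A B ^ (p / 2) - C (ε : ZMod p)) ^ 2 - (X ^ p + X) * (X ^ p - X) ^ 2

lemma numr_natDegree (hp2 : p ≠ 2) (A B : ZMod p) (ε : ℤ) (hε : ε = 1 ∨ ε = -1) :
    (numr p A B ε).natDegree ≤ 2 * p + 1 := by
  have hpp := (Fact.out : p.Prime).two_le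
  have hodd := (Fact.out : p.Prime).eq_two_or_odd
  have hε2 : C (ε : ZMod p) ^ 2 = (1 : (ZMod p)[X]) := by
    rcases hε with rfl | rfl <;> simp
  have e : numr p A B ε = C A * X ^ p + C B - C (2 * (ε : ZMod p)) * (lam A B * lam A B ^ (p / 2))
      + lam A B + X ^ (2 * p + 1) + X ^ (p + 2) - X ^ 3 := by
    have := lam_G p hp2 A B
    rw [numr, C_mul]
    simp only [map_ofNat]
    linear_combination this + lam A B * hε2
  rw [e]
  have h1 : (C (2 * (ε : ZMod p)) * (lam A B * lam A B ^ (p / 2))).natDegree ≤ 2 * p + 1 := by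
    refine (natDegree_C_mul_le _ _).trans ?_
    rw [← pow_succ', natDegree_pow, lam_natDegree]
    omega
  have h2 : (lam A B).natDegree ≤ 2 * p + 1 := by rw [lam_natDegree]; omega
  have h3 : (C A * X ^ p).natDegree ≤ 2 * p + 1 := (natDegree_C_mul_X_pow_le _ _).trans (by omega)
  have h4 : (C B).natDegree ≤ 2 * p + 1 := by simp
  have hX : ∀ n, n ≤ 2 * p + 1 → (X ^ n : (ZMod p)[X]).natDegree ≤ 2 * p + 1 := by
    intro n hn; rw [natDegree_X_pow]; exact hn
  refine (natDegree_sub_le _ _).trans (max_le ?_ (hX 3 (by omega)))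
  refine natDegree_add_le_of_degree_le ?_ (hX _ (by omega))
  refine natDegree_add_le_of_degree_le ?_ (hX _ (by omega))
  refine natDegree_add_le_of_degree_le ?_ h2
  refine (natDegree_sub_le _ _).trans (max_le ?_ h1)
  exact natDegree_add_le_of_degree_le h3 h4

lemma exists_common (hp2 : p ≠ 2) (A B : ZMod p) (ε : ℤ) (hε : ε = 1 ∨ ε = -1) :
    ∃ E : (ZMod p)[X], E ∣ numr p A B ε ∧ E ∣ (X ^ p - X) ^ 2 ∧
      (E.natDegree : ℤ) = p + ε * ∑ x : ZMod p, quadraticChar (ZMod p) (x ^ 3 + A * x + B) := by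
  classical
  set Z : Finset (ZMod p) :=
    Finset.univ.filter fun x => quadraticChar (ZMod p) (x ^ 3 + A * x + B) = 0 with hZ
  set O : Finset (ZMod p) :=
    Finset.univ.filter fun x => quadraticChar (ZMod p) (x ^ 3 + A * x + B) = ε with hO
  have hdisj : Disjoint Z O := by
    rw [Finset.disjoint_left]
    intro a ha hb
    simp only [hZ, hO, Finset.mem_filter, Finset.mem_univ, true_and] at ha hb
    rw [ha] at hb
    rcases hε with rfl | rfl <;> simp at hb
  have d0 : ∏ a ∈ Z, (X - C a) ∣ lam A B := by
    apply prod_dvd_of_roots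
    intro a ha
    simp only [hZ, Finset.mem_filter, Finset.mem_univ, true_and] at ha
    rw [lam_eval]
    exact quadraticChar_eq_zero_iff.1 ha
  have d1 : ∏ a ∈ O, (X - C a) ∣ lam A B ^ (p / 2) - C (ε : ZMod p) := by
    apply prod_dvd_of_roots
    intro a ha
    simp only [hO, Finset.mem_filter, Finset.mem_univ, true_and] at ha
    have := quadraticChar_eq_pow_of_char_ne_two' (F := ZMod p) (by rwa [ZMod.ringChar_zmod_n])
      (a ^ 3 + A * a + B)
    rw [ha, ZMod.card] at this
    rw [eval_sub, eval_pow, lam_eval, eval_C, ← this, sub_self]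
  have d2 : (∏ a ∈ Z, (X - C a)) * (∏ a ∈ O, (X - C a)) ∣ (X ^ p - X : (ZMod p)[X]) := by
    rw [← Finset.prod_union hdisj]
    apply prod_dvd_of_roots
    intro a _
    simp
  refine ⟨(∏ a ∈ Z, (X - C a)) * (∏ a ∈ O, (X - C a)) ^ 2, ?_, ?_, ?_⟩
  · rw [numr]
    refine dvd_sub (mul_dvd_mul d0 (pow_dvd_pow_of_dvd d1 2)) (Dvd.dvd.mul_left ?_ _)
    refine dvd_trans ?_ (pow_dvd_pow_of_dvd d2 2)
    rw [mul_pow]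
    exact mul_dvd_mul (dvd_pow_self _ two_ne_zero) dvd_rfl
  · refine dvd_trans ?_ (pow_dvd_pow_of_dvd d2 2)
    rw [mul_pow]
    exact mul_dvd_mul (dvd_pow_self _ two_ne_zero) dvd_rfl
  · have m : ∀ s : Finset (ZMod p), (∏ a ∈ s, (X - C a)).Monic := fun s =>
      monic_prod_of_monic _ _ fun a _ => monic_X_sub_C a
    have n : ∀ s : Finset (ZMod p), (∏ a ∈ s, (X - C a)).natDegree = s.card := fun s => by
      rw [natDegree_prod_of_monic _ _ fun a _ => monic_X_sub_C a]
      simp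
    rw [(m Z).natDegree_mul ((m O).pow 2), (m O).natDegree_pow, n, n]
    have hp : (p : ℤ) = ∑ x : ZMod p, (1 : ℤ) := by simp [ZMod.card]
    rw [hp, Finset.mul_sum, ← Finset.sum_add_distrib, hZ, hO]
    push_cast
    rw [Finset.card_filter, Finset.card_filter]
    push_cast
    rw [Finset.mul_sum, ← Finset.sum_add_distrib]
    refine Finset.sum_congr rfl fun x _ => ?_
    have h3 : quadraticChar (ZMod p) (x ^ 3 + A * x + B) = 0 ∨
        quadraticChar (ZMod p) (x ^ 3 + A * x + B) = 1 ∨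
        quadraticChar (ZMod p) (x ^ 3 + A * x + B) = -1 := by
      by_cases h : x ^ 3 + A * x + B = 0
      · left; rw [h]; simp
      · right; exact quadraticChar_dichotomy h
    rcases h3 with h | h | h <;> rcases hε with rfl | rfl <;> simp [h]

lemma X_pow_sub_X_ne : (X ^ p - X : (ZMod p)[X]) ≠ 0 :=
  FiniteField.X_pow_card_sub_X_ne_zero _ (Fact.out : p.Prime).one_lt

lemma ht_le_numr (hp2 : p ≠ 2) (A B : ZMod p) (ε : ℤ) (hε : ε = 1 ∨ ε = -1)
    (x : RatFunc (ZMod p))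
    (e : x * algebraMap (ZMod p)[X] (RatFunc (ZMod p)) ((X ^ p - X) ^ 2) =
      algebraMap (ZMod p)[X] (RatFunc (ZMod p)) (numr p A B ε)) :
    (ht x : ℤ) ≤ p + 1 - ε * ∑ x : ZMod p, quadraticChar (ZMod p) (x ^ 3 + A * x + B) := by
  obtain ⟨E, ⟨n, hn⟩, ⟨d, hd⟩, hE⟩ := exists_common p hp2 A B ε hε
  have hne : (X ^ p - X : (ZMod p)[X]) ^ 2 ≠ 0 := pow_ne_zero _ (X_pow_sub_X_ne p)
  have hE0 : E ≠ 0 := by rintro rfl; apply hne; rw [hd, zero_mul]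
  have hd0 : d ≠ 0 := by rintro rfl; apply hne; rw [hd, mul_zero]
  have nd : ((X ^ p - X : (ZMod p)[X]) ^ 2).natDegree = 2 * p := by
    rw [natDegree_pow, FiniteField.X_pow_card_sub_X_natDegree_eq _ (Fact.out : p.Prime).one_lt]
  rw [hd, natDegree_mul hE0 hd0] at nd
  have nn := numr_natDegree p hp2 A B ε hε
  have hb : n.natDegree ≤ 2 * p + 1 - E.natDegree := by
    by_cases hn0 : n = 0
    · rw [hn0]; simp
    · rw [hn, natDegree_mul hE0 hn0] at nn; omega
  have : ht x ≤ 2 * p + 1 - E.natDegree := by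
    refine ht_le x n d hd0 _ hb (by omega) ?_
    rw [hn, hd, map_mul, map_mul] at e
    have hE' : algebraMap (ZMod p)[X] (RatFunc (ZMod p)) E ≠ 0 := by
      rw [Ne, FaithfulSMul.algebraMap_eq_zero_iff]; exact hE0
    apply mul_left_cancel₀ hE'
    linear_combination e
  omega

lemma weak_hasse (hp2 : p ≠ 2) (A B : ZMod p) (hΔ : (shortWeierstrass (ZMod p) A B).Δ ≠ 0)
    (ε : ℤ) (hε : ε = 1 ∨ ε = -1) :
    6 * (ε * ∑ x : ZMod p, quadraticChar (ZMod p) (x ^ 3 + A * x + B)) ≤ p + 36 := by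
  classical
  have hl := ll_ne_zero A B
  have hε2 : (algebraMap (ZMod p)[X] (RatFunc (ZMod p)) (C (ε : ZMod p))) ^ 2 = 1 := by
    rw [← map_pow, ← C_pow]
    rcases hε with rfl | rfl <;> simp
  have hll := ll_eq A B
  have hΔ' : (TW A B).Δ ≠ 0 := by
    rw [delta_short] at hΔ ⊢
    have : -16 * (4 * (algebraMap (ZMod p)[X] (RatFunc (ZMod p)) (C A) * ll A B ^ 2) ^ 3 +
        27 * (algebraMap (ZMod p)[X] (RatFunc (ZMod p)) (C B) * ll A B ^ 3) ^ 2) =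
        ll A B ^ 6 * algebraMap (ZMod p)[X] (RatFunc (ZMod p))
          (C (-16 * (4 * A ^ 3 + 27 * B ^ 2))) := by
      simp only [map_mul, map_add, map_pow, map_neg, map_ofNat]
      ring
    rw [this]
    refine mul_ne_zero (pow_ne_zero _ hl) ?_
    rw [Ne, FaithfulSMul.algebraMap_eq_zero_iff, C_eq_zero]
    exact hΔ
  have hQ : (TW A B).Nonsingular (ll A B * algebraMap (ZMod p)[X] (RatFunc (ZMod p)) X)
      (algebraMap (ZMod p)[X] (RatFunc (ZMod p)) (C (ε : ZMod p)) * ll A B ^ 2) := by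
    rw [← equation_iff_nonsingular_of_Δ_ne_zero hΔ', equation_short]
    linear_combination ll A B ^ 4 * hε2 + ll A B ^ 3 * hll
  have hG := congrArg (algebraMap (ZMod p)[X] (RatFunc (ZMod p))) (lam_G p hp2 A B)
  have hlam : algebraMap (ZMod p)[X] (RatFunc (ZMod p)) (lam A B) = ll A B := rfl
  rw [map_mul, hlam, map_pow] at hG
  have hP : (TW A B).Nonsingular (ll A B * algebraMap (ZMod p)[X] (RatFunc (ZMod p)) (X ^ p))
      (ll A B ^ 2 * algebraMap (ZMod p)[X] (RatFunc (ZMod p)) (lam A B ^ (p / 2))) := by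
    rw [← equation_iff_nonsingular_of_Δ_ne_zero hΔ', equation_short]
    have e3 : (X ^ (3 * p) : (ZMod p)[X]) = (X ^ p) ^ 3 := by ring
    rw [e3, map_add, map_add, map_mul, map_pow _ (X ^ p) 3] at hG
    linear_combination ll A B ^ 3 * hG
  have hsub : algebraMap (ZMod p)[X] (RatFunc (ZMod p)) (X ^ p - X) ≠ 0 := by
    rw [Ne, FaithfulSMul.algebraMap_eq_zero_iff]; exact X_pow_sub_X_ne p
  have hne : ll A B * algebraMap (ZMod p)[X] (RatFunc (ZMod p)) (X ^ p) ≠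
      ll A B * algebraMap (ZMod p)[X] (RatFunc (ZMod p)) X := by
    intro h
    apply hsub
    rw [map_sub, mul_left_cancel₀ hl h, sub_self]
  have hs := six_bound A B _ hQ (Point.some _ _ hP)
  obtain ⟨x₃, y₃, h₃, x₄, y₄, h₄, i1, -, i3, -⟩ := add_sub_X hP hQ hne
  rw [i1, hpt_some, hpt_some, mul_div_cancel_left₀ _ hl, ht_algebraMap, natDegree_X_pow] at hs
  have hb := ht_le_numr p hp2 A B ε hε (x₃ / ll A B) (by
    rw [numr]
    simp only [map_sub, map_mul, map_add, map_pow] at i3 ⊢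
    rw [hlam] at i3 ⊢
    obtain ⟨ξ, rfl⟩ : ∃ ξ, x₃ = ll A B * ξ := ⟨x₃ / ll A B, by field_simp⟩
    rw [mul_div_cancel_left₀ _ hl]
    apply mul_left_cancel₀ (pow_ne_zero 3 hl)
    linear_combination i3)
  omega

end hasse

end Mestre

/-- Mestre's theorem (Theorem 5 of the paper): for a prime `p > 2²⁰` and `σ` with
`0 < |σ - p - 1| ≤ 2√p`, if every point of `E(𝔽_p)` is annihilated by `σ` and every point of
the quadratic twist `Eᵗ(𝔽_p)` is annihilated by `2p + 2 - σ`, then `#E(𝔽_p) = σ`. -/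
theorem stmt_11 (p : ℕ) [Fact p.Prime] (hp : 2 ^ 20 < p) (σ : ℕ) (hσ0 : 0 < σ)
    (hσ1 : 0 < |(σ : ℝ) - p - 1|) (hσ2 : |(σ : ℝ) - p - 1| ≤ 2 * Real.sqrt p)
    (A B α : ZMod p) (hα : ¬ IsSquare α)
    (hΔ : (shortWeierstrass (ZMod p) A B).Δ ≠ 0)
    (hE : ∀ P : (shortWeierstrass (ZMod p) A B).Point, σ • P = 0)
    (hEt : ∀ Q : (shortWeierstrass (ZMod p) ((α ^ 2)⁻¹ * A) ((α ^ 3)⁻¹ * B)).Point,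
      (2 * (p : ℤ) + 2 - (σ : ℤ)) • Q = 0) :
    Nat.card (shortWeierstrass (ZMod p) A B).Point = σ := by
  have hpp : p.Prime := Fact.out
  have hp2 : p ≠ 2 := by omega
  have hα0 : α ≠ 0 := by rintro rfl; exact hα (by simp)
  have cE := Mestre.card_short p hp2 A B hΔ
  have cEt := Mestre.card_short p hp2 _ _ (Mestre.delta_twist p A B α hα0 hΔ)
  rw [Mestre.sum_twist p hp2 A B α hα] at cEt
  have w1 := Mestre.weak_hasse p hp2 A B hΔ 1 (Or.inl rfl)
  have w2 := Mestre.weak_hasse p hp2 A B hΔ (-1) (Or.inr rfl)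
  have hcard := Mestre.card_mul_card_le p A B α hα
  generalize ∑ x : ZMod p, quadraticChar (ZMod p) (x ^ 3 + A * x + B) = S at *
  -- the bound on `σ`
  have ht : ((σ : ℤ) - p - 1) ^ 2 ≤ 4 * p := by
    have h1 : ((σ : ℝ) - p - 1) ^ 2 ≤ 4 * p := by
      have h2 := pow_le_pow_left₀ (abs_nonneg _) hσ2 2
      rw [sq_abs, mul_pow, Real.sq_sqrt (Nat.cast_nonneg p)] at h2
      linarith
    exact_mod_cast h1
  obtain ⟨t, htdef⟩ : ∃ t : ℤ, t = (σ : ℤ) - p - 1 := ⟨_, rfl⟩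
  rw [← htdef] at ht
  have hp' : (2 ^ 20 : ℤ) < p := by exact_mod_cast hp
  have ht2 : (512 * t) ^ 2 ≤ (p : ℤ) ^ 2 := by nlinarith
  have ht3 := abs_le_of_sq_le_sq' ht2 (by omega)
  by_contra hne
  obtain ⟨L, hL⟩ : ∃ L : ℕ, L = (S - t).natAbs := ⟨_, rfl⟩
  have hL0 : S - t ≠ 0 := by intro h; apply hne; omega
  have hLL : (L : ℤ) ^ 2 = (S - t) ^ 2 := by rw [hL, Int.natAbs_sq]
  have hb : 100 * (L : ℤ) ≤ 17 * p := by omega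
  have kE : ∀ P : (shortWeierstrass (ZMod p) A B).Point, L • P = 0 := by
    intro P
    have h1 : (Nat.card (shortWeierstrass (ZMod p) A B).Point : ℤ) • P = 0 := by
      rw [natCast_zsmul]; exact card_nsmul_eq_zero'
    have h2 : (σ : ℤ) • P = 0 := by rw [natCast_zsmul]; exact hE P
    have h3 : (S - t) • P = 0 := by
      have : S - t = (Nat.card (shortWeierstrass (ZMod p) A B).Point : ℤ) - σ := by omega
      rw [this, sub_zsmul, h1, h2, neg_zero, add_zero]
    rw [← natCast_zsmul]
    rcases Int.natAbs_eq (S - t) with h | h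
    · rw [hL, ← h, h3]
    · have : ((L : ℕ) : ℤ) = -(S - t) := by omega
      rw [this, neg_zsmul, h3, neg_zero]
  have kEt : ∀ Q : (shortWeierstrass (ZMod p) ((α ^ 2)⁻¹ * A) ((α ^ 3)⁻¹ * B)).Point,
      L • Q = 0 := by
    intro P
    have h1 : (Nat.card (shortWeierstrass (ZMod p) ((α ^ 2)⁻¹ * A) ((α ^ 3)⁻¹ * B)).Point : ℤ) • P
        = 0 := by
      rw [natCast_zsmul]; exact card_nsmul_eq_zero'
    have h2 := hEt P
    have h3 : (S - t) • P = 0 := by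
      have : S - t = (2 * (p : ℤ) + 2 - (σ : ℤ)) -
        (Nat.card (shortWeierstrass (ZMod p) ((α ^ 2)⁻¹ * A) ((α ^ 3)⁻¹ * B)).Point : ℤ) := by omega
      rw [this, sub_zsmul, h1, h2, neg_zero, add_zero]
    rw [← natCast_zsmul]
    rcases Int.natAbs_eq (S - t) with h | h
    · rw [hL, ← h, h3]
    · have : ((L : ℕ) : ℤ) = -(S - t) := by omega
      rw [this, neg_zsmul, h3, neg_zero]
  have hLp : (L : ZMod p) ≠ 0 := by
    rw [Ne, ZMod.natCast_eq_zero_iff]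
    intro hdvd
    have := Nat.le_of_dvd (by omega) hdvd
    omega
  have hfin := hcard L hLp kE kEt
  have hfin' : ((p : ℤ) + 1 + S) * (p + 1 + -S) ≤ 16 * (L : ℤ) ^ 2 := by
    rw [← cE, ← cEt]; exact_mod_cast hfin
  have hS : (5 * S) ^ 2 ≤ (p : ℤ) ^ 2 := sq_le_sq' (by omega) (by omega)
  have hL2 : (100 * (L : ℤ)) ^ 2 ≤ (17 * (p : ℤ)) ^ 2 := sq_le_sq' (by omega) (by omega)
  nlinarith
end

section
/- Let p be a prime, let σ be a positive integer with 0 < |σ − p − 1| ≤ 2√p, let E : y² = x³ + Ax + B be an elliptic curve over F_p with #E(F_p) ≠ σ, let α ∈ F_p be a quadratic non-residue, and let E^t : y² = x³ + α⁻²Ax + α⁻³B be the quadratic twist of E. Suppose σ·P = 0 for every P ∈ E(F_p) and (2p + 2 − σ)·Q = 0 for every Q ∈ E^t(F_p). Let e₁ and e₂ be the exponents of E(F_p) and E^t(F_p) respectively. Then gcd(e₁, e₂) > √p/4 − 1. -/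
namespace HasseAux

open Polynomial

/-- `(f : g)` represents the `x`-coordinate of the point `P`. -/
def IsX {k : Type} [Field k] {a b : k} (P : (shortWeierstrass k a b).Point) (f g : k) : Prop :=
  match P with
  | .zero => g = 0 ∧ f ≠ 0
  | .some x _ _ => g ≠ 0 ∧ f = x * g

section Kummer

variable {k : Type} [Field k] {a b : k}

lemma isX_zero {f g : k} : IsX (0 : (shortWeierstrass k a b).Point) f g ↔ g = 0 ∧ f ≠ 0 := Iff.rfl

lemma isX_some {x y f g : k} (h : (shortWeierstrass k a b).Nonsingular x y) :
    IsX (.some x y h : (shortWeierstrass k a b).Point) f g ↔ g ≠ 0 ∧ f = x * g := Iff.rfl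

lemma isX_neg {P : (shortWeierstrass k a b).Point} {f g : k} : IsX (-P) f g ↔ IsX P f g := by
  cases P <;> exact Iff.rfl

lemma isX_exists (P : (shortWeierstrass k a b).Point) : ∃ f g, IsX P f g := by
  cases P with
  | zero => exact ⟨1, 0, rfl, one_ne_zero⟩
  | some x y h => exact ⟨x, 1, one_ne_zero, by ring⟩

lemma isX_ne {P : (shortWeierstrass k a b).Point} {f g : k} (h : IsX P f g) : f ≠ 0 ∨ g ≠ 0 := by
  cases P with
  | zero => exact Or.inl h.2
  | some x y h' => exact Or.inr h.1

lemma isX_smul {P : (shortWeierstrass k a b).Point} {f g c : k} (hc : c ≠ 0) (h : IsX P f g) :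
    IsX P (c * f) (c * g) := by
  cases P with
  | zero => exact ⟨by rw [h.1, mul_zero], mul_ne_zero hc h.2⟩
  | some x y h' => exact ⟨mul_ne_zero hc h.1, by rw [h.2]; ring⟩

lemma isX_gzero {P : (shortWeierstrass k a b).Point} {f g : k} (h : IsX P f g) : P = 0 ↔ g = 0 := by
  cases P with
  | zero => exact ⟨fun _ => h.1, fun _ => rfl⟩
  | some x y h' => exact ⟨fun h2 => absurd h2 (WeierstrassCurve.Affine.Point.some_ne_zero h'),
      fun h2 => absurd h2 h.1⟩

lemma eqn_iff (x y : k) : (shortWeierstrass k a b).Equation x y ↔ y ^ 2 = x ^ 3 + a * x + b := by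
  rw [WeierstrassCurve.Affine.equation_iff]
  simp [shortWeierstrass]

lemma disc_eq : (shortWeierstrass k a b).Δ = -16 * (4 * a ^ 3 + 27 * b ^ 2) := by
  simp [shortWeierstrass, WeierstrassCurve.Δ, WeierstrassCurve.b₂, WeierstrassCurve.b₄,
    WeierstrassCurve.b₆, WeierstrassCurve.b₈]
  ring

lemma nonsing (h2 : (2 : k) ≠ 0) (hD : 4 * a ^ 3 + 27 * b ^ 2 ≠ 0) {x y : k}
    (h : y ^ 2 = x ^ 3 + a * x + b) : (shortWeierstrass k a b).Nonsingular x y := by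
  refine (WeierstrassCurve.Affine.equation_iff_nonsingular_of_Δ_ne_zero ?_).1 ((eqn_iff x y).2 h)
  have h16 : (-16 : k) ≠ 0 := by
    have : (-16 : k) = -(2 ^ 4) := by norm_num
    rw [this]
    exact neg_ne_zero.2 (pow_ne_zero _ h2)
  rw [disc_eq]
  exact mul_ne_zero h16 hD

lemma disc_identity (x : k) : (3 * x ^ 2 + 4 * a) * ((x ^ 2 - a) ^ 2 - 8 * b * x) -
    (3 * x ^ 3 - 5 * a * x - 27 * b) * (x ^ 3 + a * x + b) = 4 * a ^ 3 + 27 * b ^ 2 := by ring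

variable [DecidableEq k]

/-- The statement of the addition/subtraction map. -/
def Tri (a b x f g f₁ g₁ f₂ g₂ c : k) : Prop :=
  g₁ * g₂ = c * (f - x * g) ^ 2 ∧
  f₁ * g₂ + f₂ * g₁ = c * (2 * ((f + x * g) * (f * x + a * g) + 2 * b * g ^ 2)) ∧
  f₁ * f₂ = c * ((f * x - a * g) ^ 2 - 4 * b * g * (f + x * g))

lemma kummer_self (h2 : (2 : k) ≠ 0) (hD : 4 * a ^ 3 + 27 * b ^ 2 ≠ 0) {x y : k}
    (h : (shortWeierstrass k a b).Nonsingular x y)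
    {f g f₁ g₁ f₂ g₂ : k}
    (hP : IsX (.some x y h : (shortWeierstrass k a b).Point) f g)
    (hs : IsX (.some x y h + .some x y h : (shortWeierstrass k a b).Point) f₁ g₁)
    (hd : IsX (0 : (shortWeierstrass k a b).Point) f₂ g₂) :
    ∃ c, c ≠ 0 ∧ Tri a b x f g f₁ g₁ f₂ g₂ c := by
  have he := (eqn_iff x y).1 h.1
  obtain ⟨hg, rfl⟩ := hP
  obtain ⟨rfl, hf₂⟩ := hd
  by_cases hy : y = 0
  · subst hy
    rw [WeierstrassCurve.Affine.Point.add_self_of_Y_eq (by simp [WeierstrassCurve.Affine.negY, shortWeierstrass])] at hs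
    obtain ⟨rfl, hf₁⟩ := hs
    have hl : x ^ 3 + a * x + b = 0 := by rw [← he]; ring
    have hR : (x ^ 2 - a) ^ 2 - 8 * b * x ≠ 0 := by
      intro h0
      apply hD
      rw [← disc_identity x, hl, h0]; ring
    refine ⟨f₁ * f₂ / (g ^ 2 * ((x ^ 2 - a) ^ 2 - 8 * b * x)), by positivity, ?_, ?_, ?_⟩
    · ring
    · have : (x * g + x * g) * (x * g * x + a * g) + 2 * b * g ^ 2 = 2 * g ^ 2 * (x ^ 3 + a * x + b) := by ring
      rw [this, hl]; ring
    · have : (x * g * x - a * g) ^ 2 - 4 * b * g * (x * g + x * g) = g ^ 2 * ((x ^ 2 - a) ^ 2 - 8 * b * x) := by ring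
      rw [this, div_mul_cancel₀ _ (mul_ne_zero (pow_ne_zero 2 hg) hR)]
  · have hne : y ≠ (shortWeierstrass k a b).negY x y := by
      simp only [WeierstrassCurve.Affine.negY, shortWeierstrass]
      intro h0
      have : 2 * y = 0 := by linear_combination h0
      exact (mul_ne_zero h2 hy) this
    rw [WeierstrassCurve.Affine.Point.add_self_of_Y_ne hne] at hs
    obtain ⟨hg₁, rfl⟩ := hs
    rw [WeierstrassCurve.Affine.slope_of_Y_ne rfl hne]
    simp only [WeierstrassCurve.Affine.addX, WeierstrassCurve.Affine.negY, shortWeierstrass]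
    have hyy : y - (-y - 0 * x - 0) = 2 * y := by ring
    rw [hyy]
    refine ⟨f₂ * g₁ / (4 * g ^ 2 * y ^ 2), ?_, ?_, ?_, ?_⟩
    · have : (4 : k) = 2 ^ 2 := by norm_num
      rw [this]
      positivity
    · ring
    · have : (x * g + x * g) * (x * g * x + a * g) + 2 * b * g ^ 2 = 2 * g ^ 2 * (x ^ 3 + a * x + b) := by ring
      rw [this, ← he]
      have : (4 : k) = 2 ^ 2 := by norm_num
      rw [this]
      field_simp
      ring
    · have : (x * g * x - a * g) ^ 2 - 4 * b * g * (x * g + x * g) = g ^ 2 * ((3 * x ^ 2 + a) ^ 2 - 8 * x * (x ^ 3 + a * x + b)) := by ring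
      rw [this, ← he]
      have : (4 : k) = 2 ^ 2 := by norm_num
      rw [this]
      field_simp
      ring

lemma kummer (h2 : (2 : k) ≠ 0) (hD : 4 * a ^ 3 + 27 * b ^ 2 ≠ 0) {x y : k}
    (h : (shortWeierstrass k a b).Nonsingular x y)
    {P : (shortWeierstrass k a b).Point} {f g f₁ g₁ f₂ g₂ : k}
    (hP : IsX P f g)
    (hs : IsX (P + .some x y h) f₁ g₁)
    (hd : IsX (P - .some x y h) f₂ g₂) :
    ∃ c, c ≠ 0 ∧ Tri a b x f g f₁ g₁ f₂ g₂ c := by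
  have he := (eqn_iff x y).1 h.1
  rcases P with _ | ⟨x₁, y₁, h₁⟩
  · rw [← WeierstrassCurve.Affine.Point.zero_def] at hs hd hP
    rw [zero_add] at hs
    rw [zero_sub, isX_neg] at hd
    obtain ⟨rfl, hf⟩ := hP
    obtain ⟨hg₁, rfl⟩ := hs
    obtain ⟨hg₂, rfl⟩ := hd
    refine ⟨g₁ * g₂ / f ^ 2, by positivity, ?_, ?_, ?_⟩ <;> field_simp <;> ring
  · by_cases hx : x₁ = x
    · rcases (WeierstrassCurve.Affine.Point.X_eq_iff (h₁ := h₁) (h₂ := h)).1 hx with h0 | h0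
      · rw [h0] at hs hd hP
        rw [sub_self] at hd
        exact kummer_self h2 hD h hP hs hd
      · rw [h0] at hs hd hP
        rw [neg_add_cancel] at hs
        rw [← neg_add', isX_neg] at hd
        rw [isX_neg] at hP
        obtain ⟨c, hc, t1, t2, t3⟩ := kummer_self h2 hD h hP hd hs
        exact ⟨c, hc, by rw [← t1]; ring, by rw [← t2]; ring, by rw [← t3]; ring⟩
    · have he₁ := (eqn_iff x₁ y₁).1 h₁.1
      rw [sub_eq_add_neg, WeierstrassCurve.Affine.Point.neg_some] at hd
      rw [WeierstrassCurve.Affine.Point.add_of_X_ne hx] at hs hd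
      obtain ⟨hg, rfl⟩ := hP
      obtain ⟨hg₁, rfl⟩ := hs
      obtain ⟨hg₂, rfl⟩ := hd
      rw [WeierstrassCurve.Affine.slope_of_X_ne hx, WeierstrassCurve.Affine.slope_of_X_ne hx]
      simp only [WeierstrassCurve.Affine.addX, WeierstrassCurve.Affine.negY, shortWeierstrass]
      have hxx : x₁ - x ≠ 0 := sub_ne_zero.2 hx
      have hb : b = y₁ ^ 2 - x₁ ^ 3 - a * x₁ := by rw [he₁]; ring
      have hs1 : y ^ 2 - x ^ 3 - a * x = y₁ ^ 2 - x₁ ^ 3 - a * x₁ := by rw [he₁, he]; ring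
      have ha : a = (y₁ ^ 2 - y ^ 2 - (x₁ ^ 3 - x ^ 3)) / (x₁ - x) := by
        field_simp
        linear_combination hs1
      refine ⟨g₁ * g₂ / (g ^ 2 * (x₁ - x) ^ 2), by positivity, ?_, ?_, ?_⟩
      · field_simp
      · rw [hb, ha]
        field_simp
        ring
      · rw [hb, ha]
        field_simp
        ring

end Kummer

end HasseAux

namespace HasseAux

open Polynomial

section Prim

variable {F : Type} [Field F]

/-- Three polynomials generate the unit ideal. -/
def Prim3 (u v w : F[X]) : Prop := ∃ r s t, r * u + s * v + t * w = 1

lemma prim3_of (u v w : F[X])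
    (h : ∀ M : Ideal F[X], M.IsPrime → u ∈ M → v ∈ M → w ∈ M → False) : Prim3 u v w := by
  by_contra hc
  have hne : Ideal.span {u, v, w} ≠ ⊤ := by
    intro ht
    apply hc
    have h1 : (1 : F[X]) ∈ Ideal.span {u, v, w} := by rw [ht]; trivial
    obtain ⟨r, z, hz, h1⟩ := Ideal.mem_span_insert.1 h1
    obtain ⟨s, t, h2⟩ := Ideal.mem_span_pair.1 hz
    exact ⟨r, s, t, by rw [h1, ← h2]; ring⟩
  obtain ⟨M, hM, hle⟩ := Ideal.exists_le_maximal _ hne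
  exact h M hM.isPrime (hle (Ideal.subset_span (by simp))) (hle (Ideal.subset_span (by simp)))
    (hle (Ideal.subset_span (by simp)))

lemma coprime_not_mem {f g : F[X]} (h : IsCoprime f g) (M : Ideal F[X]) (hM : M.IsPrime)
    (hf : f ∈ M) (hg : g ∈ M) : False := by
  obtain ⟨r, s, h⟩ := h
  apply hM.ne_top
  rw [Ideal.eq_top_iff_one, ← h]
  exact M.add_mem (M.mul_mem_left _ hf) (M.mul_mem_left _ hg)

lemma prim_sym {f₁ g₁ f₂ g₂ : F[X]} (h₁ : IsCoprime f₁ g₁) (h₂ : IsCoprime f₂ g₂) :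
    Prim3 (g₁ * g₂) (f₁ * g₂ + f₂ * g₁) (f₁ * f₂) := by
  apply prim3_of
  intro M hM hu hv hw
  rcases hM.mem_or_mem hu with h | h
  · have h3 : f₁ * g₂ ∈ M := by
      have := M.sub_mem hv (M.mul_mem_left f₂ h)
      rwa [add_sub_cancel_right] at this
    rcases hM.mem_or_mem h3 with h4 | h4
    · exact coprime_not_mem h₁ M hM h4 h
    · rcases hM.mem_or_mem hw with h5 | h5
      · exact coprime_not_mem h₁ M hM h5 h
      · exact coprime_not_mem h₂ M hM h5 h4
  · have h3 : f₂ * g₁ ∈ M := by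
      have := M.sub_mem hv (M.mul_mem_left f₁ h)
      rwa [add_sub_cancel_left] at this
    rcases hM.mem_or_mem h3 with h4 | h4
    · exact coprime_not_mem h₂ M hM h4 h
    · rcases hM.mem_or_mem hw with h5 | h5
      · exact coprime_not_mem h₁ M hM h5 h4
      · exact coprime_not_mem h₂ M hM h5 h

lemma prim_add {a b : F} (h2 : (2 : F) ≠ 0) (hD : 4 * a ^ 3 + 27 * b ^ 2 ≠ 0) {f g : F[X]}
    (h : IsCoprime f g) :
    Prim3 ((f - X * g) ^ 2) (2 * ((f + X * g) * (f * X + C a * g) + 2 * C b * g ^ 2))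
      ((f * X - C a * g) ^ 2 - 4 * C b * g * (f + X * g)) := by
  apply prim3_of
  intro M hM hu hv hw
  have hS := hM.mem_of_pow_mem _ hu
  have hCne : ∀ c : F, c ≠ 0 → C c ∈ M → False := by
    intro c hc hm
    apply hM.ne_top
    rw [Ideal.eq_top_iff_one]
    have := M.mul_mem_left (C c⁻¹) hm
    rwa [← C_mul, inv_mul_cancel₀ hc, C_1] at this
  have hg : g ∉ M := by
    intro hg
    apply coprime_not_mem h M hM _ hg
    have := M.add_mem hS (M.mul_mem_left X hg)
    rwa [sub_add_cancel] at this
  have hg2 : ∀ z, g ^ 2 * z ∈ M → z ∈ M := by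
    intro z hz
    rcases hM.mem_or_mem hz with h | h
    · exact absurd (hM.mem_of_pow_mem _ h) hg
    · exact h
  have h4 : C (4 : F) ∈ M ∨ X ^ 3 + C a * X + C b ∈ M := by
    apply hM.mem_or_mem
    apply hg2
    have := M.sub_mem hv (M.mul_mem_left (2 * (f * X + C a * g) + 4 * X ^ 2 * g) hS)
    convert this using 1
    rw [show (C (4 : F) : F[X]) = 4 from rfl]
    ring
  have h5 : (X ^ 2 - C a) ^ 2 - 8 * C b * X ∈ M := by
    apply hg2
    have := M.sub_mem hw (M.mul_mem_left (X ^ 2 * (f + X * g) - 2 * C a * X * g - 4 * C b * g) hS)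
    convert this using 1
    ring
  have h4' : X ^ 3 + C a * X + C b ∈ M := by
    rcases h4 with h4 | h4
    · exact (hCne 4 (by rw [show (4 : F) = 2 ^ 2 by norm_num]; exact pow_ne_zero _ h2) h4).elim
    · exact h4
  apply hCne _ hD
  have := M.sub_mem (M.mul_mem_left (3 * X ^ 2 + 4 * C a) h5)
    (M.mul_mem_left (3 * X ^ 3 - 5 * C a * X - 27 * C b) h4')
  convert this using 1
  simp only [C_add, C_mul, C_pow]
  rw [show (C (4 : F) : F[X]) = 4 from rfl, show (C (27 : F) : F[X]) = 27 from rfl]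
  ring

lemma prim_prop {u₁ u₂ u₃ v₁ v₂ v₃ : F[X]} (hu : Prim3 u₁ u₂ u₃) (hv : Prim3 v₁ v₂ v₃)
    {K : Type} [Field K] [Algebra F[X] K] [IsFractionRing F[X] K] (c : K)
    (h1 : algebraMap F[X] K v₁ = c * algebraMap F[X] K u₁)
    (h2 : algebraMap F[X] K v₂ = c * algebraMap F[X] K u₂)
    (h3 : algebraMap F[X] K v₃ = c * algebraMap F[X] K u₃) :
    ∃ e : F, e ≠ 0 ∧ v₁ = C e * u₁ ∧ v₂ = C e * u₂ ∧ v₃ = C e * u₃ := by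
  have inj := IsFractionRing.injective F[X] K
  obtain ⟨r, s, t, hu⟩ := hu
  obtain ⟨r', s', t', hv⟩ := hv
  have hc : c = algebraMap F[X] K (r * v₁ + s * v₂ + t * v₃) := by
    have := congrArg (algebraMap F[X] K) hu
    simp only [map_add, map_mul, map_one] at this ⊢
    rw [h1, h2, h3]
    linear_combination (-c) * this
  set d := r * v₁ + s * v₂ + t * v₃ with hd
  rw [hc, ← map_mul] at h1 h2 h3
  have h1 := inj h1
  have h2 := inj h2
  have h3 := inj h3
  have hunit : IsUnit d := by
    apply IsUnit.of_mul_eq_one (r' * u₁ + s' * u₂ + t' * u₃)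
    rw [← hv, h1, h2, h3]
    ring
  obtain ⟨e, he, hed⟩ := Polynomial.isUnit_iff.1 hunit
  refine ⟨e, he.ne_zero, ?_, ?_, ?_⟩ <;> rw [hed] <;> assumption

end Prim

end HasseAux

namespace HasseAux

open Polynomial

section FunField

variable {F : Type} [Field F]

/-- The cubic. -/
noncomputable def lam (a b : F) : F[X] := X ^ 3 + C a * X + C b

/-- The cubic in the function field. -/
noncomputable def lamK (a b : F) : RatFunc F := algebraMap F[X] (RatFunc F) (lam a b)

/-- The twist by the cubic over the function field. -/
noncomputable abbrev EK (a b : F) : WeierstrassCurve.Affine (RatFunc F) :=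
  shortWeierstrass (RatFunc F) (algebraMap F[X] (RatFunc F) (C a) * lamK a b ^ 2)
    (algebraMap F[X] (RatFunc F) (C b) * lamK a b ^ 3)

lemma lam_natDegree (a b : F) : (lam a b).natDegree = 3 := by
  unfold lam
  compute_degree!

lemma lam_ne (a b : F) : lam a b ≠ 0 := by
  intro h
  have := lam_natDegree a b
  rw [h] at this
  simp at this

lemma lam_eval (a b x : F) : (lam a b).eval x = x ^ 3 + a * x + b := by
  simp [lam]

lemma am_inj {f g : F[X]} : algebraMap F[X] (RatFunc F) f = algebraMap F[X] (RatFunc F) g ↔ f = g :=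
  (IsFractionRing.injective F[X] (RatFunc F)).eq_iff

lemma lamK_ne (a b : F) : lamK a b ≠ 0 := by
  unfold lamK
  rw [Ne, ← map_zero (algebraMap F[X] (RatFunc F)), am_inj]
  exact lam_ne a b

variable {a b : F}

/-- numerator of x-coordinate -/
noncomputable def fn (P : (EK a b).Point) : F[X] :=
  match P with
  | .zero => 1
  | .some x _ _ => (x / lamK a b).num

/-- denominator of x-coordinate -/
noncomputable def fd (P : (EK a b).Point) : F[X] :=
  match P with
  | .zero => 0
  | .some x _ _ => (x / lamK a b).denom

lemma coprime_fn_fd (P : (EK a b).Point) : IsCoprime (fn P) (fd P) := by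
  cases P with
  | zero => exact isCoprime_one_left
  | some x y h => exact RatFunc.isCoprime_num_denom _

lemma isX_fn (P : (EK a b).Point) :
    IsX P (lamK a b * algebraMap F[X] (RatFunc F) (fn P)) (algebraMap F[X] (RatFunc F) (fd P)) := by
  cases P with
  | zero => exact ⟨map_zero _, by
      change lamK a b * algebraMap F[X] (RatFunc F) 1 ≠ 0
      rw [map_one, mul_one]; exact lamK_ne a b⟩
  | some x y h =>
    have hd : algebraMap F[X] (RatFunc F) (x / lamK a b).denom ≠ 0 := by
      rw [Ne, ← map_zero (algebraMap F[X] (RatFunc F)), am_inj]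
      exact RatFunc.denom_ne_zero _
    refine ⟨hd, ?_⟩
    have h1 := RatFunc.num_div_denom (x / lamK a b)
    change lamK a b * algebraMap F[X] (RatFunc F) (x / lamK a b).num = x * algebraMap F[X] (RatFunc F) (x / lamK a b).denom
    have := lamK_ne a b
    field_simp at h1
    rw [← h1]

lemma isX_repr {P : (EK a b).Point} {f g : F[X]} (hc : IsCoprime f g)
    (h : IsX P (lamK a b * algebraMap F[X] (RatFunc F) f) (algebraMap F[X] (RatFunc F) g)) :
    ∃ e : F, e ≠ 0 ∧ f = C e * fn P ∧ g = C e * fd P := by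
  have h0 := isX_fn P
  have hx : f * fd P = g * fn P := by
    rw [← am_inj (F := F), map_mul, map_mul]
    apply mul_left_cancel₀ (lamK_ne a b)
    cases P with
    | zero => rw [h.1, h0.1]; ring
    | some x y hh => linear_combination (algebraMap F[X] (RatFunc F) (fd (.some x y hh))) * h.2 -
          (algebraMap F[X] (RatFunc F) g) * h0.2
  obtain ⟨r, s, hrs⟩ := hc
  obtain ⟨r', s', hrs'⟩ := coprime_fn_fd P
  have hf : f = (r' * f + s' * g) * fn P := by linear_combination (-f) * hrs' + s' * hx
  have hg : g = (r' * f + s' * g) * fd P := by linear_combination (-g) * hrs' - r' * hx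
  have hunit : IsUnit (r' * f + s' * g) := by
    apply IsUnit.of_mul_eq_one (r * fn P + s * fd P)
    linear_combination (-r) * hf - s * hg + hrs
  obtain ⟨e, he, hed⟩ := Polynomial.isUnit_iff.1 hunit
  exact ⟨e, he.ne_zero, by rw [hed]; exact hf, by rw [hed]; exact hg⟩

lemma h2K (h2 : (2 : F) ≠ 0) : (2 : RatFunc F) ≠ 0 := by
  have : (2 : RatFunc F) = algebraMap F (RatFunc F) 2 := (map_ofNat _ 2).symm
  rw [this]
  simpa using h2

lemma hDK (hD : 4 * a ^ 3 + 27 * b ^ 2 ≠ 0) :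
    4 * (algebraMap F[X] (RatFunc F) (C a) * lamK a b ^ 2) ^ 3 +
    27 * (algebraMap F[X] (RatFunc F) (C b) * lamK a b ^ 3) ^ 2 ≠ 0 := by
  have : 4 * (algebraMap F[X] (RatFunc F) (C a) * lamK a b ^ 2) ^ 3 +
    27 * (algebraMap F[X] (RatFunc F) (C b) * lamK a b ^ 3) ^ 2 =
      algebraMap F[X] (RatFunc F) (C (4 * a ^ 3 + 27 * b ^ 2)) * lamK a b ^ 6 := by
    simp only [map_add, map_mul, map_pow]
    rw [show (C (4 : F) : F[X]) = 4 from rfl, show (C (27 : F) : F[X]) = 27 from rfl]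
    simp only [map_ofNat]
    ring
  rw [this]
  refine mul_ne_zero ?_ (pow_ne_zero _ (lamK_ne a b))
  rw [Ne, ← map_zero (algebraMap F[X] (RatFunc F)), am_inj]
  exact C_ne_zero.2 hD

lemma eqK (x y : F[X]) (h : lam a b * y ^ 2 = x ^ 3 + C a * x + C b) :
    (lamK a b ^ 2 * algebraMap F[X] (RatFunc F) y) ^ 2 = (lamK a b * algebraMap F[X] (RatFunc F) x) ^ 3 +
      (algebraMap F[X] (RatFunc F) (C a) * lamK a b ^ 2) * (lamK a b * algebraMap F[X] (RatFunc F) x) +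
      (algebraMap F[X] (RatFunc F) (C b) * lamK a b ^ 3) := by
  have := congrArg (algebraMap F[X] (RatFunc F)) h
  simp only [map_mul, map_add, map_pow] at this
  change lamK a b * _ = _ at this
  linear_combination lamK a b ^ 3 * this

/-- The point of `EK` with coordinates from polynomials. -/
noncomputable def ptK (h2 : (2 : F) ≠ 0) (hD : 4 * a ^ 3 + 27 * b ^ 2 ≠ 0)
    (x y : F[X]) (h : lam a b * y ^ 2 = x ^ 3 + C a * x + C b) : (EK a b).Point :=
  .some _ _ (nonsing (h2K h2) (hDK hD) (eqK x y h))

lemma fn_ptK (h2 : (2 : F) ≠ 0) (hD : 4 * a ^ 3 + 27 * b ^ 2 ≠ 0)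
    (x y : F[X]) (h : lam a b * y ^ 2 = x ^ 3 + C a * x + C b) :
    fn (ptK h2 hD x y h) = x := by
  change (lamK a b * algebraMap F[X] (RatFunc F) x / lamK a b).num = x
  rw [mul_div_cancel_left₀ _ (lamK_ne a b), RatFunc.num_algebraMap]

lemma fd_ptK (h2 : (2 : F) ≠ 0) (hD : 4 * a ^ 3 + 27 * b ^ 2 ≠ 0)
    (x y : F[X]) (h : lam a b * y ^ 2 = x ^ 3 + C a * x + C b) :
    fd (ptK h2 hD x y h) = 1 := by
  change (lamK a b * algebraMap F[X] (RatFunc F) x / lamK a b).denom = 1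
  rw [mul_div_cancel_left₀ _ (lamK_ne a b), RatFunc.denom_algebraMap]

/-- The generic point. -/
noncomputable def Q (h2 : (2 : F) ≠ 0) (hD : 4 * a ^ 3 + 27 * b ^ 2 ≠ 0) : (EK a b).Point :=
  ptK h2 hD X 1 (by rw [lam]; ring)

variable [DecidableEq (RatFunc F)]

lemma kummerPoly (h2 : (2 : F) ≠ 0) (hD : 4 * a ^ 3 + 27 * b ^ 2 ≠ 0) (P : (EK a b).Point) :
    ∃ e : F, e ≠ 0 ∧
    fd (P + Q h2 hD) * fd (P - Q h2 hD) = C e * ((fn P - X * fd P) ^ 2) ∧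
    fn (P + Q h2 hD) * fd (P - Q h2 hD) + fn (P - Q h2 hD) * fd (P + Q h2 hD) =
      C e * (2 * ((fn P + X * fd P) * (fn P * X + C a * fd P) + 2 * C b * fd P ^ 2)) ∧
    fn (P + Q h2 hD) * fn (P - Q h2 hD) =
      C e * ((fn P * X - C a * fd P) ^ 2 - 4 * C b * fd P * (fn P + X * fd P)) := by
  obtain ⟨c, hc, t1, t2, t3⟩ := kummer (h2K h2) (hDK hD) (nonsing (h2K h2) (hDK hD) (eqK X 1 (by rw [lam]; ring))) (isX_fn P)
    (isX_fn (P + Q h2 hD)) (isX_fn (P - Q h2 hD))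
  have hl := lamK_ne a b
  refine prim_prop (K := RatFunc F) (prim_add h2 hD (coprime_fn_fd P))
    (prim_sym (coprime_fn_fd _) (coprime_fn_fd _)) (c * lamK a b ^ 2) ?_ ?_ ?_
  · simp only [map_mul, map_add, map_sub, map_pow, map_ofNat]
    rw [t1]; ring
  · apply mul_left_cancel₀ hl
    simp only [map_mul, map_add, map_sub, map_pow, map_ofNat]
    linear_combination t2
  · apply mul_left_cancel₀ (pow_ne_zero 2 hl)
    simp only [map_mul, map_add, map_sub, map_pow, map_ofNat]
    linear_combination t3

/-- The denominators have smaller degree. -/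
def Good (P : (EK a b).Point) : Prop := (fd P).degree < (fn P).degree

lemma good_natDegree {P : (EK a b).Point} (h : Good P) : fn P ≠ 0 ∧
    (fd P = 0 ∨ (fd P).natDegree < (fn P).natDegree) := by
  refine ⟨fun h0 => by simp [Good, h0] at h, ?_⟩
  by_cases h0 : fd P = 0
  · exact Or.inl h0
  · exact Or.inr (Polynomial.natDegree_lt_natDegree h0 h)

lemma degree_step {f g f₁ g₁ f₂ g₂ : F[X]} {e : F} (he : e ≠ 0) (hfg : g.degree < f.degree)
    (t1 : g₁ * g₂ = C e * ((f - X * g) ^ 2))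
    (t2 : f₁ * g₂ + f₂ * g₁ = C e * (2 * ((f + X * g) * (f * X + C a * g) + 2 * C b * g ^ 2)))
    (t3 : f₁ * f₂ = C e * ((f * X - C a * g) ^ 2 - 4 * C b * g * (f + X * g))) :
    g₁.degree < f₁.degree ∧ g₂.degree < f₂.degree ∧
      f₁.natDegree + f₂.natDegree = 2 * f.natDegree + 2 := by
  have hf0 : f ≠ 0 := by rintro rfl; simp at hfg
  set d := f.natDegree with hd
  have hXg : (X * g).natDegree ≤ d := by
    by_cases h0 : g = 0
    · simp [h0]
    · rw [natDegree_X_mul h0]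
      exact natDegree_lt_natDegree h0 hfg
  have hgd : g.natDegree ≤ d := natDegree_le_natDegree hfg.le
  have hCag : (C a * g).natDegree ≤ d := (natDegree_C_mul_le _ _).trans hgd
  have hfX : (f * X).natDegree = d + 1 := natDegree_mul_X hf0
  have hsum : (f + X * g).natDegree ≤ d := natDegree_add_le_of_degree_le le_rfl hXg
  have b1 : (g₁ * g₂).natDegree ≤ 2 * d := by
    rw [t1]
    refine (natDegree_C_mul_le _ _).trans ((natDegree_pow_le).trans ?_)
    have : (f - X * g).natDegree ≤ d := (natDegree_sub_le_of_le le_rfl hXg).trans (by simp [hd])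
    omega
  have b2 : (f₁ * g₂ + f₂ * g₁).natDegree ≤ 2 * d + 1 := by
    rw [t2]
    refine (natDegree_C_mul_le _ _).trans ?_
    rw [show (2 : F[X]) = C 2 from rfl, show (C 2 * C b : F[X]) = C (2 * b) from C_mul.symm]
    refine (natDegree_C_mul_le _ _).trans ?_
    apply natDegree_add_le_of_degree_le
    · refine natDegree_mul_le.trans ?_
      have : (f * X + C a * g).natDegree ≤ d + 1 := natDegree_add_le_of_degree_le hfX.le (by omega)
      omega
    · refine (natDegree_C_mul_le _ _).trans ((natDegree_pow_le).trans ?_)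
      omega
  have b3 : (f₁ * f₂).natDegree = 2 * d + 2 := by
    rw [t3, natDegree_C_mul he]
    have h1 : (f * X - C a * g).natDegree = d + 1 := by
      rw [natDegree_sub_eq_left_of_natDegree_lt (by omega), hfX]
    have h2 : (4 * C b * g * (f + X * g)).natDegree ≤ 2 * d := by
      rw [show (4 : F[X]) = C 4 from rfl, show (C 4 * C b : F[X]) = C (4 * b) from C_mul.symm]
      refine natDegree_mul_le.trans ?_
      have := (natDegree_C_mul_le (4 * b) g)
      omega
    have h3 : ((f * X - C a * g) ^ 2).natDegree = 2 * d + 2 := by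
      rw [natDegree_pow, h1]; ring
    rw [natDegree_sub_eq_left_of_natDegree_lt (by omega), h3]
  have hne : f₁ * f₂ ≠ 0 := by
    intro h0
    rw [h0] at b3
    simp at b3
  have hf₁ := left_ne_zero_of_mul hne
  have hf₂ := right_ne_zero_of_mul hne
  have hdeg : f₁.natDegree + f₂.natDegree = 2 * d + 2 := by rw [← natDegree_mul hf₁ hf₂, b3]
  have aux : ∀ f₁ g₁ f₂ g₂ : F[X], f₁ ≠ 0 → f₂ ≠ 0 → (g₁ * g₂).natDegree ≤ 2 * d →
      (f₁ * g₂ + f₂ * g₁).natDegree ≤ 2 * d + 1 → f₁.natDegree + f₂.natDegree = 2 * d + 2 →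
      g₂.degree < f₂.degree := by
    intro f₁ g₁ f₂ g₂ hf₁ hf₂ b1 b2 b3
    by_contra hle
    rw [not_lt] at hle
    have hg₂ : g₂ ≠ 0 := by
      rintro rfl
      simp only [degree_zero, le_bot_iff, degree_eq_bot] at hle
      exact hf₂ hle
    have hle' := natDegree_le_natDegree hle
    by_cases hg₁ : g₁ = 0
    · rw [hg₁, mul_zero, add_zero, natDegree_mul hf₁ hg₂] at b2
      omega
    · rw [natDegree_mul hg₁ hg₂] at b1
      have h1 := natDegree_mul hf₁ hg₂
      have h2 := natDegree_mul hf₂ hg₁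
      rw [natDegree_add_eq_left_of_natDegree_lt (by omega)] at b2
      omega
  refine ⟨aux f₂ g₂ f₁ g₁ hf₂ hf₁ (by rwa [mul_comm]) (by rwa [add_comm]) (by rwa [add_comm]),
    aux f₁ g₁ f₂ g₂ hf₁ hf₂ b1 b2 hdeg, hdeg⟩

lemma good_step (h2 : (2 : F) ≠ 0) (hD : 4 * a ^ 3 + 27 * b ^ 2 ≠ 0) {P : (EK a b).Point}
    (h : Good P) : Good (P + Q h2 hD) ∧ Good (P - Q h2 hD) ∧
    (fn (P + Q h2 hD)).natDegree + (fn (P - Q h2 hD)).natDegree = 2 * (fn P).natDegree + 2 := by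
  obtain ⟨e, he, t1, t2, t3⟩ := kummerPoly h2 hD P
  exact degree_step he h t1 t2 t3

lemma good_zero : Good (0 : (EK a b).Point) := by
  change degree (0 : F[X]) < degree (1 : F[X])
  simp

lemma good_int (h2 : (2 : F) ≠ 0) (hD : 4 * a ^ 3 + 27 * b ^ 2 ≠ 0) {P : (EK a b).Point}
    (h : Good P) (n : ℤ) : Good (P + n • Q h2 hD) := by
  induction n using Int.induction_on with
  | zero => simpa using h
  | succ i ih =>
    have := (good_step h2 hD ih).1
    rwa [add_assoc, ← add_one_zsmul] at this
  | pred i ih =>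
    have := (good_step h2 hD ih).2.1
    rwa [add_sub_assoc, sub_eq_add_neg (_ • _), ← sub_one_zsmul] at this

/-- A sequence with constant second difference `2` is quadratic. -/
lemma quad_seq (d : ℤ → ℤ) (h : ∀ n, d (n + 1) + d (n - 1) = 2 * d n + 2) (n : ℤ) :
    d n = n ^ 2 + (d 0 + 1 - d (-1)) * n + d 0 := by
  have key : ∀ n : ℤ, d n = n ^ 2 + (d 0 + 1 - d (-1)) * n + d 0 ∧
      d (n - 1) = (n - 1) ^ 2 + (d 0 + 1 - d (-1)) * (n - 1) + d 0 := by
    intro n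
    induction n using Int.induction_on with
    | zero => constructor <;> simp; ring
    | succ i ih =>
      have := h i
      refine ⟨by linarith [ih.1, ih.2], ?_⟩
      rw [add_sub_cancel_right]; exact ih.1
    | pred i ih =>
      have := h (-(i : ℤ) - 1)
      rw [sub_add_cancel] at this
      refine ⟨ih.2, by linarith [ih.1, ih.2]⟩
  exact (key n).1

lemma deg_quad (h2 : (2 : F) ≠ 0) (hD : 4 * a ^ 3 + 27 * b ^ 2 ≠ 0) {P : (EK a b).Point}
    (h : Good P) (n : ℤ) : ((fn (P + n • Q h2 hD)).natDegree : ℤ) = n ^ 2 +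
      ((fn P).natDegree + 1 - (fn (P - Q h2 hD)).natDegree) * n + (fn P).natDegree := by
  have := quad_seq (fun n : ℤ => ((fn (P + n • Q h2 hD)).natDegree : ℤ)) (fun n => by
    have := (good_step h2 hD (good_int h2 hD h n)).2.2
    rw [add_assoc, ← add_one_zsmul, add_sub_assoc, sub_eq_add_neg (_ • _), ← sub_one_zsmul] at this
    exact_mod_cast this) n
  simpa [← sub_eq_add_neg] using this

end FunField

end HasseAux

namespace HasseAux

open Polynomial

section Count

variable {F : Type} [Field F] [Fintype F] [DecidableEq F] {a b : F}

lemma card_point (hF : ringChar F ≠ 2) (h2 : (2 : F) ≠ 0) (hD : 4 * a ^ 3 + 27 * b ^ 2 ≠ 0) :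
    (Nat.card (shortWeierstrass F a b).Point : ℤ) =
      1 + ∑ x : F, (quadraticChar F (x ^ 3 + a * x + b) + 1) := by
  have e1 := Nat.card_congr ((shortWeierstrass F a b).nonsingularPointEquiv)
  have e2 : Nat.card (WithZero {xy : F × F // (shortWeierstrass F a b).Nonsingular xy.1 xy.2}) =
      Nat.card {xy : F × F // (shortWeierstrass F a b).Nonsingular xy.1 xy.2} + 1 :=
    Finite.card_option
  have e3 : Nat.card {xy : F × F // (shortWeierstrass F a b).Nonsingular xy.1 xy.2} =
      Nat.card (Σ x : F, {y : F // y ^ 2 = x ^ 3 + a * x + b}) := by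
    apply Nat.card_congr
    refine ⟨fun z => ⟨z.1.1, z.1.2, (eqn_iff _ _).1 z.2.1⟩,
      fun z => ⟨(z.1, z.2.1), nonsing h2 hD z.2.2⟩, fun z => rfl, fun z => rfl⟩
  rw [e1, e2, e3, Nat.card_sigma]
  push_cast
  rw [add_comm]
  congr 1
  apply Finset.sum_congr rfl
  intro x _
  rw [← quadraticChar_card_sqrts hF]
  rw [Nat.card_eq_fintype_card, Set.toFinset_card]
  rfl

lemma sum_rootMult_le (g : F[X]) : ∑ x : F, g.rootMultiplicity x ≤ g.natDegree := by
  have : ∑ x : F, g.rootMultiplicity x = Multiset.card g.roots := by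
    rw [← Multiset.sum_count_eq_card (s := Finset.univ) (fun _ _ => Finset.mem_univ _)]
    exact Finset.sum_congr rfl fun x _ => (count_roots g).symm
  rw [this]
  exact card_roots' g

lemma sum_rootMult_eq {g : F[X]} (hg : g.Splits) : ∑ x : F, g.rootMultiplicity x = g.natDegree := by
  have : ∑ x : F, g.rootMultiplicity x = Multiset.card g.roots := by
    rw [← Multiset.sum_count_eq_card (s := Finset.univ) (fun _ _ => Finset.mem_univ _)]
    exact Finset.sum_congr rfl fun x _ => (count_roots g).symm
  rw [this]
  exact hg.natDegree_eq_card_roots.symm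

end Count

section Spec

variable {F : Type} [Field F] {a b : F}

lemma fn_neg (P : (EK a b).Point) : fn (-P) = fn P := by cases P <;> rfl

lemma fn_zero : fn (0 : (EK a b).Point) = 1 := rfl
lemma fd_zero : fd (0 : (EK a b).Point) = 0 := rfl

lemma mult_two {P : (EK a b).Point} {x₀ : F} (hP : P ≠ 0) (hl : (lam a b).eval x₀ ≠ 0)
    (h0 : (fd P).eval x₀ = 0) : 2 ≤ (fd P).rootMultiplicity x₀ := by
  have hco := coprime_fn_fd P
  have hX := isX_fn P
  have hg : fd P ≠ 0 := by
    intro h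
    apply hP
    rw [isX_gzero hX, h, map_zero]
  have hm1 : 0 < (fd P).rootMultiplicity x₀ := (rootMultiplicity_pos hg).2 h0
  set f := fn P
  set g := fd P
  have hf : f.eval x₀ ≠ 0 := by
    intro hf
    obtain ⟨r, s, hrs⟩ := hco
    have := congrArg (Polynomial.eval x₀) hrs
    simp [hf, h0] at this
  cases P with
  | zero => exact absurd rfl hP
  | some x y h =>
    have he := (eqn_iff x y).1 h.1
    have hgK : algebraMap F[X] (RatFunc F) g ≠ 0 := hX.1
    have hx : x = lamK a b * algebraMap F[X] (RatFunc F) f / algebraMap F[X] (RatFunc F) g := by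
      rw [eq_div_iff hgK]; exact hX.2.symm
    have hdK : algebraMap F[X] (RatFunc F) y.denom ≠ 0 := by
      rw [Ne, ← map_zero (algebraMap F[X] (RatFunc F)), am_inj]
      exact RatFunc.denom_ne_zero _
    have hy : y = algebraMap F[X] (RatFunc F) y.num / algebraMap F[X] (RatFunc F) y.denom :=
      (RatFunc.num_div_denom y).symm
    have hpoly : y.num ^ 2 * g ^ 3 =
        lam a b ^ 3 * (f ^ 3 + C a * f * g ^ 2 + C b * g ^ 3) * y.denom ^ 2 := by
      rw [← am_inj (F := F)]
      simp only [map_mul, map_add, map_pow]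
      change _ = lamK a b ^ 3 * _ * _
      rw [hx] at he
      generalize algebraMap F[X] (RatFunc F) y.num = u at *
      generalize algebraMap F[X] (RatFunc F) y.denom = v at *
      rw [hy] at he
      field_simp at he
      linear_combination he
    have hev : (lam a b ^ 3 * (f ^ 3 + C a * f * g ^ 2 + C b * g ^ 3)).eval x₀ ≠ 0 := by
      simp only [eval_mul, eval_add, eval_pow, eval_C, h0]
      simp [hl, hf]
    have hz : (lam a b ^ 3 * (f ^ 3 + C a * f * g ^ 2 + C b * g ^ 3)).rootMultiplicity x₀ = 0 :=
      rootMultiplicity_eq_zero hev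
    have hrhs : lam a b ^ 3 * (f ^ 3 + C a * f * g ^ 2 + C b * g ^ 3) * y.denom ^ 2 ≠ 0 := by
      refine mul_ne_zero ?_ (pow_ne_zero _ (RatFunc.denom_ne_zero _))
      intro h
      rw [h] at hev
      simp at hev
    have hlhs := hpoly ▸ hrhs
    have hm := congrArg (rootMultiplicity x₀) hpoly
    rw [rootMultiplicity_mul hrhs, rootMultiplicity_mul hlhs, hz] at hm
    have hn : y.num ≠ 0 := by
      intro h
      rw [h] at hlhs
      simp at hlhs
    have hd := RatFunc.denom_ne_zero y
    have p1 : (y.num ^ 2).rootMultiplicity x₀ = 2 * y.num.rootMultiplicity x₀ := by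
      rw [pow_two, rootMultiplicity_mul (mul_ne_zero hn hn)]; ring
    have p2 : (y.denom ^ 2).rootMultiplicity x₀ = 2 * y.denom.rootMultiplicity x₀ := by
      rw [pow_two, rootMultiplicity_mul (mul_ne_zero hd hd)]; ring
    have p3 : (g ^ 3).rootMultiplicity x₀ = 3 * g.rootMultiplicity x₀ := by
      rw [pow_succ, pow_two, rootMultiplicity_mul (mul_ne_zero (mul_ne_zero hg hg) hg),
        rootMultiplicity_mul (mul_ne_zero hg hg)]; ring
    omega

variable [DecidableEq F] [DecidableEq (RatFunc F)]

lemma spec (h2 : (2 : F) ≠ 0) (hD : 4 * a ^ 3 + 27 * b ^ 2 ≠ 0) {x y : F}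
    (h : (shortWeierstrass F a b).Nonsingular x y) (n : ℕ) :
    IsX (n • (.some x y h : (shortWeierstrass F a b).Point))
      ((fn (n • Q h2 hD)).eval x) ((fd (n • Q h2 hD)).eval x) ∧
    IsX ((n + 1) • (.some x y h : (shortWeierstrass F a b).Point))
      ((fn ((n + 1) • Q h2 hD)).eval x) ((fd ((n + 1) • Q h2 hD)).eval x) := by
  induction n with
  | zero =>
    constructor
    · have e0 : (0 : ℕ) • Q h2 hD = 0 := zero_nsmul _
      have e1 : (0 : ℕ) • (.some x y h : (shortWeierstrass F a b).Point) = 0 := zero_nsmul _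
      rw [e0, e1, fn_zero, fd_zero, isX_zero]
      simp
    · simp only [zero_add, one_smul]
      rw [Q, fn_ptK, fd_ptK, isX_some]
      simp
  | succ n ih =>
    refine ⟨ih.2, ?_⟩
    obtain ⟨ih1, ih2⟩ := ih
    obtain ⟨f₁, g₁, h₁⟩ := isX_exists ((n + 1 + 1) • (.some x y h : (shortWeierstrass F a b).Point))
    have e1 : (n + 1 + 1) • (.some x y h : (shortWeierstrass F a b).Point) =
      (n + 1) • (.some x y h : (shortWeierstrass F a b).Point) + .some x y h := succ_nsmul _ _
    have e2 : n • (.some x y h : (shortWeierstrass F a b).Point) =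
      (n + 1) • (.some x y h : (shortWeierstrass F a b).Point) - .some x y h := by
      rw [succ_nsmul, add_sub_cancel_right]
    have e3 : (n + 1 + 1) • Q h2 hD = (n + 1) • Q h2 hD + Q h2 hD := succ_nsmul _ _
    have e4 : n • Q h2 hD = (n + 1) • Q h2 hD - Q h2 hD := by
      rw [succ_nsmul, add_sub_cancel_right]
    obtain ⟨c, hc, t1, t2, t3⟩ := kummer h2 hD h ih2 (e1 ▸ h₁) (e2 ▸ ih1)
    obtain ⟨e, he, s1, s2, s3⟩ := kummerPoly h2 hD ((n + 1) • Q h2 hD)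
    rw [← e3, ← e4] at s1 s2 s3
    have s1 := congrArg (Polynomial.eval x) s1
    have s2 := congrArg (Polynomial.eval x) s2
    have s3 := congrArg (Polynomial.eval x) s3
    simp only [eval_mul, eval_add, eval_sub, eval_pow, eval_C, eval_X, eval_ofNat] at s1 s2 s3
    have hne := isX_ne ih1
    have hk : e / c ≠ 0 := div_ne_zero he hc
    have key := isX_smul hk h₁
    set f₂ := eval x (fn (n • Q h2 hD))
    set g₂ := eval x (fd (n • Q h2 hD))
    set f₃ := eval x (fn ((n + 1 + 1) • Q h2 hD))
    set g₃ := eval x (fd ((n + 1 + 1) • Q h2 hD))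
    have r1 : (g₃ - e / c * g₁) * g₂ = 0 := by
      have : (g₃ - e / c * g₁) * g₂ = g₃ * g₂ - e / c * (g₁ * g₂) := by ring
      rw [this, s1, t1]; field_simp; ring
    have r3 : (f₃ - e / c * f₁) * f₂ = 0 := by
      have : (f₃ - e / c * f₁) * f₂ = f₃ * f₂ - e / c * (f₁ * f₂) := by ring
      rw [this, s3, t3]; field_simp; ring
    have r2 : (f₃ - e / c * f₁) * g₂ + f₂ * (g₃ - e / c * g₁) = 0 := by
      have : (f₃ - e / c * f₁) * g₂ + f₂ * (g₃ - e / c * g₁) =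
        (f₃ * g₂ + f₂ * g₃) - e / c * (f₁ * g₂ + f₂ * g₁) := by ring
      rw [this, s2, t2]; field_simp; ring
    have hfin : f₃ - e / c * f₁ = 0 ∧ g₃ - e / c * g₁ = 0 := by
      rcases hne with hf | hg
      · have hA : f₃ - e / c * f₁ = 0 := (mul_eq_zero.1 r3).resolve_right hf
        rw [hA, zero_mul, zero_add] at r2
        exact ⟨hA, (mul_eq_zero.1 r2).resolve_left hf⟩
      · have hB : g₃ - e / c * g₁ = 0 := (mul_eq_zero.1 r1).resolve_right hg
        rw [hB, mul_zero, add_zero] at r2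
        exact ⟨(mul_eq_zero.1 r2).resolve_right hg, hB⟩
    rw [sub_eq_zero.1 hfin.1, sub_eq_zero.1 hfin.2]
    exact key

lemma deg_nQ (h2 : (2 : F) ≠ 0) (hD : 4 * a ^ 3 + 27 * b ^ 2 ≠ 0) (n : ℕ) :
    (fn (n • Q h2 hD)).natDegree = n ^ 2 := by
  have := deg_quad h2 hD (good_zero (a := a) (b := b)) n
  rw [zero_add, zero_sub, fn_neg, natCast_zsmul] at this
  rw [show fn (Q h2 hD) = X from fn_ptK _ _ _ _ _, fn_zero] at this
  simp at this
  exact_mod_cast this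

theorem card_le_sq [Fintype F] (hF : ringChar F ≠ 2) (h2 : (2 : F) ≠ 0)
    (hD : 4 * a ^ 3 + 27 * b ^ 2 ≠ 0) (e : ℕ) (he : 0 < e)
    (hkill : ∀ P : (shortWeierstrass F a b).Point, e • P = 0) :
    Nat.card (shortWeierstrass F a b).Point ≤ e ^ 2 := by
  have hdeg := deg_nQ h2 hD e
  have hgood : Good (e • Q h2 hD) := by
    have := good_int h2 hD (good_zero (a := a) (b := b)) e
    rwa [zero_add, natCast_zsmul] at this
  have hne : e • Q h2 hD ≠ 0 := by
    intro h
    rw [h, fn_zero] at hdeg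
    rw [natDegree_one] at hdeg
    have := pow_pos he 2
    omega
  have hlt : (fd (e • Q h2 hD)).natDegree + 1 ≤ e ^ 2 := by
    rw [← hdeg]
    rcases (good_natDegree hgood).2 with h | h
    · rw [h, hdeg, natDegree_zero]
      exact pow_pos he 2
    · exact h
  have hg : fd (e • Q h2 hD) ≠ 0 := by
    intro h
    apply hne
    rw [isX_gzero (isX_fn _), h, map_zero]
  have hroot : ∀ x y : F, y ^ 2 = x ^ 3 + a * x + b → (fd (e • Q h2 hD)).eval x = 0 := by
    intro x y hxy
    have := (spec h2 hD (nonsing h2 hD hxy) e).1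
    rw [hkill, isX_zero] at this
    exact this.1
  have hsum : ∑ x : F, (quadraticChar F (x ^ 3 + a * x + b) + 1) ≤
      ∑ x : F, ((fd (e • Q h2 hD)).rootMultiplicity x : ℤ) := by
    apply Finset.sum_le_sum
    intro x _
    by_cases h0 : x ^ 3 + a * x + b = 0
    · rw [h0, quadraticChar_zero]
      have := (rootMultiplicity_pos hg).2 (hroot x 0 (by rw [h0]; ring))
      omega
    · rcases quadraticChar_dichotomy h0 with h1 | h1
      · rw [h1]
        obtain ⟨y, hy⟩ := (quadraticChar_one_iff_isSquare h0).1 h1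
        have := mult_two hne (by rwa [lam_eval]) (hroot x y (by rw [hy]; ring))
        omega
      · rw [h1]
        positivity
  have := sum_rootMult_le (fd (e • Q h2 hD))
  have h3 := card_point hF h2 hD
  zify at *
  linarith

end Spec

end HasseAux

namespace HasseAux

open Polynomial

section Hasse

variable {F : Type} [Field F] [Fintype F] {a b : F}

/-- The Artin-Schreier type polynomial. -/
noncomputable def DD (F : Type) [Field F] [Fintype F] : F[X] := X ^ Fintype.card F - X

/-- The numerator. -/
noncomputable def NN (a b : F) : F[X] :=
  lam a b * (lam a b ^ (Fintype.card F / 2) + 1) ^ 2 - (X ^ Fintype.card F + X) * DD F ^ 2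

lemma DD_eval (x : F) : (DD F).eval x = 0 := by
  simp [DD, FiniteField.pow_card]

lemma DD_natDegree : (DD F).natDegree = Fintype.card F :=
  FiniteField.X_pow_card_sub_X_natDegree_eq F Fintype.one_lt_card

lemma DD_ne : DD F ≠ 0 := FiniteField.X_pow_card_sub_X_ne_zero F Fintype.one_lt_card

lemma DD_roots : (DD F).roots = Finset.univ.val := FiniteField.roots_X_pow_card_sub_X F

lemma DD_mult (x : F) : (DD F).rootMultiplicity x = 1 := by
  classical
  rw [← count_roots, DD_roots]
  exact Multiset.count_eq_one_of_mem Finset.univ.nodup (Finset.mem_univ x)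

lemma DD_splits : (DD F).Splits := by
  rw [splits_iff_card_roots, DD_roots, DD_natDegree]
  rfl

lemma lam_frob (hq : Odd (Fintype.card F)) :
    lam a b * (lam a b ^ (Fintype.card F / 2)) ^ 2 =
      (X ^ Fintype.card F) ^ 3 + C a * X ^ Fintype.card F + C b := by
  have h1 := FiniteField.expand_card (lam a b)
  have h2 : Fintype.card F = 2 * (Fintype.card F / 2) + 1 := by
    obtain ⟨k, hk⟩ := hq
    omega
  have h3 : lam a b * (lam a b ^ (Fintype.card F / 2)) ^ 2 = lam a b ^ Fintype.card F := by
    conv_rhs => rw [h2]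
    ring
  rw [h3, ← h1]
  simp [lam]

lemma NN_eq (hq : Odd (Fintype.card F)) : NN a b = X ^ (2 * Fintype.card F + 1) +
    (X ^ (Fintype.card F + 2) - X ^ 3 + C a * X ^ Fintype.card F + C b +
      (2 : F[X]) * lam a b ^ (Fintype.card F / 2 + 1) + lam a b) := by
  have := lam_frob (a := a) (b := b) hq
  unfold NN DD
  linear_combination this

lemma NN_natDegree (hq : Odd (Fintype.card F)) (hq3 : 3 ≤ Fintype.card F) :
    (NN a b).natDegree = 2 * Fintype.card F + 1 := by
  rw [NN_eq hq, natDegree_add_eq_left_of_natDegree_lt, natDegree_X_pow]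
  rw [natDegree_X_pow, Nat.lt_succ_iff]
  obtain ⟨k, hk⟩ := hq
  have hlam := lam_natDegree a b
  have hpow : (lam a b ^ (Fintype.card F / 2 + 1)).natDegree ≤ 2 * Fintype.card F := by
    rw [natDegree_pow, hlam]; omega
  have htwo : ((2 : F[X]) * lam a b ^ (Fintype.card F / 2 + 1)).natDegree ≤ 2 * Fintype.card F := by
    refine (natDegree_mul_le).trans ?_
    rw [natDegree_ofNat, zero_add]
    exact hpow
  refine natDegree_add_le_of_degree_le (natDegree_add_le_of_degree_le (natDegree_add_le_of_degree_le
    (natDegree_add_le_of_degree_le ?_ ?_) ?_) htwo) ?_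
  · refine (natDegree_sub_le _ _).trans ?_
    rw [natDegree_X_pow, natDegree_X_pow]; omega
  · refine (natDegree_C_mul_X_pow_le _ _).trans ?_; omega
  · rw [natDegree_C]; omega
  · rw [hlam]; omega

lemma NN_eval (x : F) : (NN a b).eval x =
    (x ^ 3 + a * x + b) * ((x ^ 3 + a * x + b) ^ (Fintype.card F / 2) + 1) ^ 2 := by
  unfold NN
  simp [DD_eval, lam_eval]

lemma NN_deriv (x : F) : (derivative (NN a b)).eval x =
    (3 * x ^ 2 + a) * ((x ^ 3 + a * x + b) ^ (Fintype.card F / 2) + 1) ^ 2 +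
    (x ^ 3 + a * x + b) * (2 * ((x ^ 3 + a * x + b) ^ (Fintype.card F / 2) + 1) *
      (derivative (lam a b ^ (Fintype.card F / 2))).eval x) := by
  have h1 : (derivative (lam a b)).eval x = 3 * x ^ 2 + a := by
    simp [lam]
    left
    norm_num
  unfold NN
  rw [derivative_sub, derivative_mul, derivative_mul, pow_two, pow_two, derivative_mul,
    derivative_mul, derivative_add, derivative_one]
  simp only [eval_add, eval_sub, eval_mul, DD_eval, eval_pow, eval_one, lam_eval, h1]
  simp
  ring

variable [DecidableEq F]

lemma count_deg (hF : ringChar F ≠ 2) (h2 : (2 : F) ≠ 0) (hD : 4 * a ^ 3 + 27 * b ^ 2 ≠ 0)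
    (hq : Odd (Fintype.card F)) (hq3 : 3 ≤ Fintype.card F)
    {f g : F[X]} (hco : IsCoprime f g) (hg : g ≠ 0) (hfg : f * DD F ^ 2 = g * NN a b) :
    (f.natDegree : ℤ) = 1 + ∑ x : F, (quadraticChar F (x ^ 3 + a * x + b) + 1) := by
  have hN : NN a b ≠ 0 := by
    intro h
    have := NN_natDegree (a := a) (b := b) hq hq3
    rw [h, natDegree_zero] at this
    omega
  have hrhs : g * NN a b ≠ 0 := mul_ne_zero hg hN
  have hlhs : f * DD F ^ 2 ≠ 0 := hfg ▸ hrhs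
  have hf : f ≠ 0 := left_ne_zero_of_mul hlhs
  have hD2 : DD F ^ 2 ≠ 0 := pow_ne_zero _ DD_ne
  have hdeg : f.natDegree = g.natDegree + 1 := by
    have := congrArg natDegree hfg
    rw [natDegree_mul hf hD2, natDegree_mul hg hN, natDegree_pow, DD_natDegree,
      NN_natDegree hq hq3] at this
    omega
  have hsplit : g.Splits := by
    refine Splits.of_dvd (DD_splits.pow 2) hD2 ?_
    refine hco.symm.dvd_of_dvd_mul_left ?_
    exact ⟨_, hfg⟩
  have hsum := sum_rootMult_eq hsplit
  have hpt : ∀ x : F, (g.rootMultiplicity x : ℤ) = quadraticChar F (x ^ 3 + a * x + b) + 1 := by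
    intro x
    have hm := congrArg (rootMultiplicity x) hfg
    rw [rootMultiplicity_mul hlhs, rootMultiplicity_mul hrhs, pow_two,
      rootMultiplicity_mul (by rwa [← pow_two]), DD_mult] at hm
    have hmin : f.rootMultiplicity x = 0 ∨ g.rootMultiplicity x = 0 := by
      by_contra! hcon
      have r1 := (rootMultiplicity_pos hf).1 (Nat.pos_of_ne_zero hcon.1)
      have r2 := (rootMultiplicity_pos hg).1 (Nat.pos_of_ne_zero hcon.2)
      obtain ⟨r, s, hrs⟩ := hco
      have := congrArg (Polynomial.eval x) hrs
      rw [IsRoot.def] at r1 r2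
      simp [r1, r2] at this
    have hχ := quadraticChar_eq_pow_of_char_ne_two' hF (x ^ 3 + a * x + b)
    by_cases h0 : x ^ 3 + a * x + b = 0
    · have hk : Fintype.card F / 2 ≠ 0 := by omega
      have hroot : (NN a b).IsRoot x := by
        rw [IsRoot.def, NN_eval, h0, zero_mul]
      have hder : ¬ (derivative (NN a b)).IsRoot x := by
        rw [IsRoot.def, NN_deriv, h0, zero_pow hk]
        intro h
        apply hD
        have h3 : 3 * x ^ 2 + a = 0 := by linear_combination h
        linear_combination (3 * x ^ 2 + 4 * a) * (3 * x ^ 2 + a) * h3 +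
          (-8 * x * (3 * x ^ 2 + 4 * a) - (3 * x ^ 3 - 5 * a * x - 27 * b)) * h0
      have p1 := (rootMultiplicity_pos hN).2 hroot
      have p2 := (one_lt_rootMultiplicity_iff_isRoot (t := x) hN).not.2 (fun h => hder h.2)
      rw [h0, quadraticChar_zero]
      omega
    · rcases quadraticChar_dichotomy h0 with h1 | h1
      · rw [h1] at hχ ⊢
        have : (NN a b).rootMultiplicity x = 0 := by
          apply rootMultiplicity_eq_zero
          rw [IsRoot.def, NN_eval, ← hχ]
          push_cast
          refine mul_ne_zero h0 (pow_ne_zero _ ?_)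
          rwa [one_add_one_eq_two]
        omega
      · rw [h1] at hχ ⊢
        have hz : (x ^ 3 + a * x + b) ^ (Fintype.card F / 2) + 1 = 0 := by
          rw [← hχ]; push_cast; ring
        have := (one_lt_rootMultiplicity_iff_isRoot (t := x) hN).2 (by
          rw [IsRoot.def, IsRoot.def, NN_deriv, NN_eval, hz]
          constructor <;> ring)
        omega
  rw [hdeg, ← hsum]
  push_cast
  rw [Finset.sum_congr rfl (fun x _ => hpt x)]
  ring

theorem hasse (hF : ringChar F ≠ 2) (h2 : (2 : F) ≠ 0) (hD : 4 * a ^ 3 + 27 * b ^ 2 ≠ 0)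
    (hq : Odd (Fintype.card F)) (hq3 : 3 ≤ Fintype.card F) :
    ((Fintype.card F : ℤ) + 1 - Nat.card (shortWeierstrass F a b).Point) ^ 2 ≤
      4 * Fintype.card F := by
  classical
  set P0 : (EK a b).Point := ptK h2 hD (X ^ Fintype.card F) (lam a b ^ (Fintype.card F / 2))
    (lam_frob hq) with hP0
  have hfn : fn P0 = X ^ Fintype.card F := fn_ptK _ _ _ _ _
  have hfd : fd P0 = 1 := fd_ptK _ _ _ _ _
  have hgood : Good P0 := by
    rw [Good, hfn, hfd, degree_one, degree_X_pow]
    exact_mod_cast (by omega : 0 < Fintype.card F)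
  set f := fn (P0 - Q h2 hD) with hf
  set g := fd (P0 - Q h2 hD) with hg
  have hX := isX_fn (P0 - Q h2 hD)
  rw [← hf, ← hg] at hX
  have hl := lamK_ne a b
  set am := algebraMap F[X] (RatFunc F) with ham
  have hDDK : am (DD F) ≠ 0 := by
    rw [ham, Ne, ← map_zero (algebraMap F[X] (RatFunc F)), am_inj]
    exact DD_ne
  have hDDe : am (DD F) = am (X ^ Fintype.card F) - am X := by rw [DD, map_sub]
  have hxne : lamK a b * am (X ^ Fintype.card F) ≠ lamK a b * am X := by
    intro h
    have := mul_left_cancel₀ hl h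
    rw [hDDe, this, sub_self] at hDDK
    exact hDDK rfl
  have hrel : g ≠ 0 ∧ f * DD F ^ 2 = g * NN a b := by
    rw [sub_eq_add_neg, hP0, Q, ptK, ptK, WeierstrassCurve.Affine.Point.neg_some,
      WeierstrassCurve.Affine.Point.add_of_X_ne hxne, isX_some] at hX
    refine ⟨fun h => hX.1 (by rw [h, map_zero]), ?_⟩
    have h1 := hX.2
    rw [WeierstrassCurve.Affine.slope_of_X_ne hxne] at h1
    simp only [WeierstrassCurve.Affine.addX, WeierstrassCurve.Affine.negY, shortWeierstrass] at h1
    rw [← am_inj (F := F)]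
    unfold NN
    simp only [map_mul, map_pow, map_sub, map_add, map_one] at *
    rw [← ham] at *
    change _ = _ * (lamK a b * _ - _)
    have h5 : lamK a b * am X ^ Fintype.card F - lamK a b * am X = lamK a b * am (DD F) := by
      rw [hDDe]; ring
    rw [h5] at h1
    clear hX h5 hDDe
    generalize am (lam a b) ^ (Fintype.card F / 2) = s at *
    generalize am X ^ Fintype.card F = u at *
    generalize am X = v at *
    generalize am (DD F) = d at *
    generalize am f = f' at *
    generalize am g = g' at *
    generalize lamK a b = l at *
    have h6 : (l ^ 2 * s - (-(l ^ 2 * 1) - 0 * (l * v) - 0)) / (l * d) = l * (s + 1) / d := by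
      field_simp
      ring
    rw [h6] at h1
    apply mul_left_cancel₀ hl
    field_simp at h1
    linear_combination h1
  have hco : IsCoprime f g := coprime_fn_fd _
  have hdegf := count_deg hF h2 hD hq hq3 hco hrel.1 hrel.2
  rw [← card_point hF h2 hD] at hdegf
  have hquad := fun n => deg_quad h2 hD hgood n
  rw [← hf, hdegf, hfn, natDegree_X_pow] at hquad
  obtain ⟨k, hk⟩ := hq
  generalize (Nat.card (shortWeierstrass F a b).Point : ℤ) = N at *
  have hpos : ∀ n : ℤ, 0 ≤ n ^ 2 + ((Fintype.card F : ℤ) + 1 - N) * n + Fintype.card F := by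
    intro n
    rw [← hquad n]
    positivity
  have hk' : (Fintype.card F : ℤ) = 2 * k + 1 := by exact_mod_cast hk
  generalize (Fintype.card F : ℤ) = q at *
  generalize q + 1 - N = t at *
  rcases Int.even_or_odd' t with ⟨m, hm | hm⟩
  · have := hpos (-m)
    rw [hm] at this ⊢
    linarith [this, show (2 * m) ^ 2 = 4 * m ^ 2 by ring, show 2 * m * -m = -2 * m ^ 2 by ring,
      show (-m) ^ 2 = m ^ 2 by ring]
  · have h3 := hpos (-m)
    rw [hm] at h3 ⊢
    obtain ⟨r, hr⟩ := (Int.even_mul_succ_self m)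
    have h4 : m ^ 2 + m ≤ q := by nlinarith
    have h5 : m ^ 2 + m = r + r := by rw [← hr]; ring
    have h6 : m ^ 2 + m + 1 ≤ q := by omega
    nlinarith

end Hasse

end HasseAux

namespace HasseAux

lemma twist_sum {F : Type} [Field F] [Fintype F] [DecidableEq F] (hF : ringChar F ≠ 2)
    (A B α : F) (hα : ¬ IsSquare α) :
    ∑ x : F, quadraticChar F (x ^ 3 + (α ^ 2)⁻¹ * A * x + (α ^ 3)⁻¹ * B) =
      - ∑ x : F, quadraticChar F (x ^ 3 + A * x + B) := by
  have hα0 : α ≠ 0 := fun h => hα (h ▸ ⟨0, by ring⟩)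
  rw [← Finset.sum_neg_distrib]
  rw [← Equiv.sum_comp (Equiv.mulLeft₀ α⁻¹ (inv_ne_zero hα0))]
  apply Finset.sum_congr rfl
  intro x _
  have h1 : (Equiv.mulLeft₀ α⁻¹ (inv_ne_zero hα0)) x = α⁻¹ * x := rfl
  have h2 : (α⁻¹ * x) ^ 3 + (α ^ 2)⁻¹ * A * (α⁻¹ * x) + (α ^ 3)⁻¹ * B =
      α * ((α⁻¹) ^ 2) ^ 2 * (x ^ 3 + A * x + B) := by
    field_simp
  rw [h1, h2, map_mul, map_mul, map_pow, quadraticChar_sq_one (pow_ne_zero _ (inv_ne_zero hα0)),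
    quadraticChar_neg_one_iff_not_isSquare.2 hα]
  ring

lemma disc_twist {F : Type} [Field F] {A B α : F} (hα0 : α ≠ 0) (hD : 4 * A ^ 3 + 27 * B ^ 2 ≠ 0) :
    4 * ((α ^ 2)⁻¹ * A) ^ 3 + 27 * ((α ^ 3)⁻¹ * B) ^ 2 ≠ 0 := by
  have : 4 * ((α ^ 2)⁻¹ * A) ^ 3 + 27 * ((α ^ 3)⁻¹ * B) ^ 2 =
      (α⁻¹) ^ 6 * (4 * A ^ 3 + 27 * B ^ 2) := by
    field_simp
  rw [this]
  exact mul_ne_zero (pow_ne_zero _ (inv_ne_zero hα0)) hD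

lemma final (p : ℕ) (hp : 3 ≤ p) (N M e₁ e₂ σ : ℕ) (hN : N ≤ e₁ ^ 2) (hM : M ≤ e₂ ^ 2)
    (hNM : (N : ℤ) + M = 2 * p + 2) (ht : ((p : ℤ) + 1 - N) ^ 2 ≤ 4 * p)
    (hσ2 : |(σ : ℝ) - p - 1| ≤ 2 * Real.sqrt p) (hne : N ≠ σ)
    (h1 : e₁ ∣ N) (h2 : e₁ ∣ σ) (h3 : e₂ ∣ M) (h4 : (e₂ : ℤ) ∣ 2 * p + 2 - σ) :
    Real.sqrt p / 4 - 1 < (Nat.gcd e₁ e₂ : ℝ) := by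
  have hp0 : (0 : ℝ) ≤ p := by positivity
  have hs0 : 0 ≤ Real.sqrt p := Real.sqrt_nonneg _
  have hsq : Real.sqrt p * Real.sqrt p = p := Real.mul_self_sqrt hp0
  have hp3 : (3 : ℝ) ≤ p := by exact_mod_cast hp
  have hs1 : 1 < Real.sqrt p := by nlinarith
  have htR : |(N : ℝ) - p - 1| ≤ 2 * Real.sqrt p := by
    apply abs_le_of_sq_le_sq _ (by positivity)
    have : (((p : ℤ) + 1 - N : ℤ) : ℝ) ^ 2 ≤ 4 * p := by exact_mod_cast ht
    push_cast at this
    nlinarith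
  have hd1 : (e₁ : ℤ) ∣ N - σ :=
    dvd_sub (Int.natCast_dvd_natCast.2 h1) (Int.natCast_dvd_natCast.2 h2)
  have hd2 : (e₂ : ℤ) ∣ N - σ := by
    have := dvd_sub h4 (Int.natCast_dvd_natCast.2 h3)
    have e : (2 * (p : ℤ) + 2 - σ - M) = N - σ := by linarith
    rwa [e] at this
  have hl : Nat.lcm e₁ e₂ ∣ ((N : ℤ) - σ).natAbs :=
    Nat.lcm_dvd (Int.natCast_dvd.1 hd1) (Int.natCast_dvd.1 hd2)
  have hl2 : Nat.lcm e₁ e₂ ≤ ((N : ℤ) - σ).natAbs := Nat.le_of_dvd (by omega) hl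
  have hl3 : (Nat.lcm e₁ e₂ : ℝ) ≤ 4 * Real.sqrt p := by
    have e1 : ((Nat.lcm e₁ e₂ : ℤ) : ℝ) ≤ ((|(N : ℤ) - σ| : ℤ) : ℝ) := by
      rw [Int.abs_eq_natAbs]
      exact_mod_cast hl2
    push_cast at e1
    rw [abs_le] at htR hσ2
    refine e1.trans (abs_le.2 ⟨?_, ?_⟩) <;> linarith
  have hgl : ((Nat.gcd e₁ e₂ : ℝ)) * Nat.lcm e₁ e₂ = e₁ * e₂ := by
    exact_mod_cast Nat.gcd_mul_lcm e₁ e₂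
  have hprod : ((p : ℝ) - 1) ≤ e₁ * e₂ := by
    refine le_of_abs_le (abs_le_of_sq_le_sq ?_ (by positivity))
    have hNR : (N : ℝ) ≤ (e₁ : ℝ) ^ 2 := by exact_mod_cast hN
    have hMR : (M : ℝ) ≤ (e₂ : ℝ) ^ 2 := by exact_mod_cast hM
    have : (N : ℝ) * M ≤ (e₁ : ℝ) ^ 2 * (e₂ : ℝ) ^ 2 :=
      mul_le_mul hNR hMR (by positivity) (by positivity)
    have hsum : (N : ℝ) + M = 2 * p + 2 := by exact_mod_cast hNM
    have ht' : (((p : ℤ) + 1 - N : ℤ) : ℝ) ^ 2 ≤ 4 * p := by exact_mod_cast ht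
    push_cast at ht'
    have hMe : (M : ℝ) = 2 * p + 2 - N := by linarith
    rw [hMe] at this
    nlinarith
  have hg0 : (0 : ℝ) ≤ Nat.gcd e₁ e₂ := by positivity
  have : (p : ℝ) - 1 ≤ Nat.gcd e₁ e₂ * (4 * Real.sqrt p) :=
    hprod.trans (hgl ▸ mul_le_mul_of_nonneg_left hl3 hg0)
  by_contra! hcon
  have h5 := mul_le_mul_of_nonneg_right hcon (show 0 ≤ 4 * Real.sqrt p by positivity)
  nlinarith

end HasseAux

/-- Under the hypotheses of the annihilation conditions with `0 < |σ - p - 1| ≤ 2√p` and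
`#E(𝔽_p) ≠ σ`, the exponents `e₁`, `e₂` of `E(𝔽_p)` and of its quadratic twist `Eᵗ(𝔽_p)`
satisfy `gcd(e₁, e₂) > √p/4 - 1`. -/
theorem stmt_14 (p : ℕ) [Fact p.Prime] (σ : ℕ) (hσ0 : 0 < σ)
    (hσ1 : 0 < |(σ : ℝ) - p - 1|) (hσ2 : |(σ : ℝ) - p - 1| ≤ 2 * Real.sqrt p)
    (A B α : ZMod p) (hα : ¬ IsSquare α)
    (hΔ : (shortWeierstrass (ZMod p) A B).Δ ≠ 0)
    (hcard : Nat.card (shortWeierstrass (ZMod p) A B).Point ≠ σ)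
    (hE : ∀ P : (shortWeierstrass (ZMod p) A B).Point, σ • P = 0)
    (hEt : ∀ Q : (shortWeierstrass (ZMod p) ((α ^ 2)⁻¹ * A) ((α ^ 3)⁻¹ * B)).Point,
      (2 * (p : ℤ) + 2 - (σ : ℤ)) • Q = 0)
    (e₁ e₂ : ℕ)
    (he₁ : e₁ = AddMonoid.exponent (shortWeierstrass (ZMod p) A B).Point)
    (he₂ : e₂ = AddMonoid.exponent
      (shortWeierstrass (ZMod p) ((α ^ 2)⁻¹ * A) ((α ^ 3)⁻¹ * B)).Point) :
    Real.sqrt p / 4 - 1 < (Nat.gcd e₁ e₂ : ℝ) := by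
  have hpp : p.Prime := Fact.out
  letI : DecidableEq (RatFunc (ZMod p)) := Classical.decEq _
  have hF : ringChar (ZMod p) ≠ 2 := by
    intro h
    exact hα (FiniteField.isSquare_of_char_two h α)
  have hp2 : p ≠ 2 := by
    intro h
    apply hF
    rw [ZMod.ringChar_zmod_n, h]
  have h2 : (2 : ZMod p) ≠ 0 := Ring.two_ne_zero hF
  have hα0 : α ≠ 0 := fun h => hα (h ▸ ⟨0, by ring⟩)
  have hD : 4 * A ^ 3 + 27 * B ^ 2 ≠ 0 := by
    intro h
    rw [HasseAux.disc_eq, h, mul_zero] at hΔ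
    exact hΔ rfl
  have hD' := HasseAux.disc_twist hα0 hD
  have hodd : Odd (Fintype.card (ZMod p)) := by
    rw [ZMod.card]; exact hpp.odd_of_ne_two hp2
  have hp3 : 3 ≤ p := by
    have := hpp.two_le
    omega
  have hq3 : 3 ≤ Fintype.card (ZMod p) := by rwa [ZMod.card]
  have c1 := HasseAux.card_point hF h2 hD
  have c2 := HasseAux.card_point hF h2 hD'
  rw [Finset.sum_add_distrib] at c1 c2
  rw [HasseAux.twist_sum hF A B α hα] at c2
  have hH := HasseAux.hasse hF h2 hD hodd hq3
  simp only [Finset.sum_const, Finset.card_univ, ZMod.card, nsmul_eq_mul, mul_one] at c1 c2 hH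
  have hsum : (Nat.card (shortWeierstrass (ZMod p) A B).Point : ℤ) +
      Nat.card (shortWeierstrass (ZMod p) ((α ^ 2)⁻¹ * A) ((α ^ 3)⁻¹ * B)).Point = 2 * p + 2 := by
    linarith
  have hfin : ∀ a b : ZMod p, Finite (shortWeierstrass (ZMod p) a b).Point := fun a b =>
    Finite.of_equiv (Option {xy : ZMod p × ZMod p // (shortWeierstrass (ZMod p) a b).Nonsingular xy.1 xy.2})
      ((shortWeierstrass (ZMod p) a b).nonsingularPointEquiv).symm
  haveI := hfin A B
  haveI := hfin ((α ^ 2)⁻¹ * A) ((α ^ 3)⁻¹ * B)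
  have hpos1 : 0 < e₁ := by
    rw [he₁]; exact AddMonoid.exponent_pos.2 AddMonoid.ExponentExists.of_finite
  have hpos2 : 0 < e₂ := by
    rw [he₂]; exact AddMonoid.exponent_pos.2 AddMonoid.ExponentExists.of_finite
  have hN := HasseAux.card_le_sq hF h2 hD e₁ hpos1 (fun P => by
    rw [he₁]; exact AddMonoid.exponent_nsmul_eq_zero P)
  have hM := HasseAux.card_le_sq hF h2 hD' e₂ hpos2 (fun P => by
    rw [he₂]; exact AddMonoid.exponent_nsmul_eq_zero P)
  refine HasseAux.final p hp3 _ _ e₁ e₂ σ hN hM hsum hH hσ2 hcard ?_ ?_ ?_ ?_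
  · rw [he₁]; exact AddGroup.exponent_dvd_nat_card
  · rw [he₁]; exact AddMonoid.exponent_dvd_of_forall_nsmul_eq_zero hE
  · rw [he₂]; exact AddGroup.exponent_dvd_nat_card
  · rw [he₂, Int.natCast_dvd]
    apply AddMonoid.exponent_dvd_of_forall_nsmul_eq_zero
    intro Q
    rcases Int.natAbs_eq (2 * (p : ℤ) + 2 - σ) with h | h
    · rw [← natCast_zsmul, ← h]; exact hEt Q
    · rw [← natCast_zsmul, ← neg_eq_zero, ← neg_zsmul, ← h]; exact hEt Q
end
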